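/- arXiv:1412.4838 — 11 statements merged into one kernel-verified Lean document; each statement's English description precedes it below -/
import Mathlib

section
/- Let Ω ⊆ ℝ³ be a connected open set containing the closure of S₂, and let r : ℝ³ → ℝ be real-analytic on Ω (AnalyticOn ℝ) with r(p) = 0 for every p ∈ S₂. Then r is identically zero on Ω. -/
/-- `t x y = x - sin(1/(y+2))`. -/
noncomputable def tfun (x y : ℝ) : ℝ := x - Real.sin (1 / (y + 2))

/-- The variety `S₂ ⊆ ℝ³`. -/
def S2 : Set (ℝ × ℝ × ℝ) :=
  {p | -2 < p.2.1 ∧ p.2.1 < 2 ∧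
    p.2.2 ^ 2 = (1 - tfun p.1 p.2.1 ^ 2 - p.2.1 ^ 2) * tfun p.1 p.2.1 ^ 2}

open Filter Topology Asymptotics

/-- The partial derivative in the last coordinate. -/
noncomputable def partialZ (g : ℝ × ℝ × ℝ → ℝ) : ℝ × ℝ × ℝ → ℝ :=
  fun p => fderiv ℝ g p (0, 0, 1)

lemma analyticAt_partialZ {g : ℝ × ℝ × ℝ → ℝ} {p : ℝ × ℝ × ℝ} (h : AnalyticAt ℝ g p) :
    AnalyticAt ℝ (partialZ g) p :=
  ((ContinuousLinearMap.apply ℝ ℝ ((0, 0, 1) : ℝ × ℝ × ℝ)).analyticAt _).comp h.fderiv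

lemma analyticAt_partialZ_iterate {g : ℝ × ℝ × ℝ → ℝ} {p : ℝ × ℝ × ℝ}
    (h : AnalyticAt ℝ g p) (n : ℕ) : AnalyticAt ℝ (partialZ^[n] g) p := by
  induction n generalizing g with
  | zero => exact h
  | succ n ih => exact ih (analyticAt_partialZ h)

lemma hasDerivAt_partialZ {g : ℝ × ℝ × ℝ → ℝ} {x y z : ℝ}
    (h : DifferentiableAt ℝ g (x, y, z)) :
    HasDerivAt (fun w => g (x, y, w)) (partialZ g (x, y, z)) z := by
  have h1 : HasDerivAt (fun w : ℝ => ((x, y, w) : ℝ × ℝ × ℝ)) (0, 0, 1) z :=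
    (hasDerivAt_const z x).prodMk ((hasDerivAt_const z y).prodMk (hasDerivAt_id z))
  exact h.hasFDerivAt.comp_hasDerivAt z h1

/-- The Taylor coefficient of order `j` in the last variable, at height `0`. -/
noncomputable def taylorZ (g : ℝ × ℝ × ℝ → ℝ) (j : ℕ) (x y : ℝ) : ℝ :=
  (partialZ^[j] g) (x, y, 0) / j.factorial

lemma isBigO_sub_taylorZ {g : ℝ × ℝ × ℝ → ℝ} {x₀ y₀ : ℝ} (hg : AnalyticAt ℝ g (x₀, y₀, 0))
    (n : ℕ) :
    (fun p : ℝ × ℝ × ℝ => g p - ∑ j ∈ Finset.range n, taylorZ g j p.1 p.2.1 * p.2.2 ^ j)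
      =O[𝓝 (x₀, y₀, 0)] fun p => p.2.2 ^ n := by
  induction n generalizing g with
  | zero =>
    simp only [Finset.range_zero, Finset.sum_empty, sub_zero, pow_zero]
    exact hg.continuousAt.norm.isBoundedUnder_le.isBigO_one ℝ
  | succ n ih =>
    obtain ⟨C, hC₀, hC⟩ := (ih (analyticAt_partialZ hg)).exists_nonneg
    rw [isBigOWith_iff] at hC
    obtain ⟨ε, hε, hball⟩ := Metric.eventually_nhds_iff_ball.1 (hC.and hg.eventually_analyticAt)
    refine IsBigO.of_bound C (Metric.eventually_nhds_iff_ball.2 ⟨ε, hε, ?_⟩)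
    rintro ⟨x, y, z⟩ hp
    have hin : ∀ w ∈ Set.Icc (-|z|) |z|, ((x, y, w) : ℝ × ℝ × ℝ) ∈ Metric.ball (x₀, y₀, 0) ε := by
      intro w hw
      simp only [Metric.mem_ball, Prod.dist_eq, max_lt_iff, Real.dist_eq, sub_zero] at hp ⊢
      exact ⟨hp.1, hp.2.1, (abs_le.2 hw).trans_lt hp.2.2⟩
    have hder : ∀ w ∈ Set.Icc (-|z|) |z|, HasDerivWithinAt
        (fun w => g (x, y, w) - ∑ j ∈ Finset.range (n + 1), taylorZ g j x y * w ^ j)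
        (partialZ g (x, y, w) - ∑ j ∈ Finset.range n, taylorZ (partialZ g) j x y * w ^ j)
        (Set.Icc (-|z|) |z|) w := by
      intro w hw
      refine (HasDerivAt.sub (hasDerivAt_partialZ (hball _ (hin w hw)).2.differentiableAt)
        ?_).hasDerivWithinAt
      simp only [Finset.sum_range_succ']
      have := (HasDerivAt.fun_sum (u := Finset.range n) (x := w)
        (A := fun j w => taylorZ g (j + 1) x y * w ^ (j + 1))
        (A' := fun j => taylorZ (partialZ g) j x y * w ^ j) (fun j _ => by
          refine ((hasDerivAt_pow (j + 1) w).const_mul (taylorZ g (j + 1) x y)).congr_deriv ?_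
          simp only [taylorZ, Function.iterate_succ, Function.comp, Nat.factorial_succ]
          have : (j.factorial : ℝ) ≠ 0 := by positivity
          push_cast
          field_simp))
      simpa using this.add_const (taylorZ g 0 x y * w ^ 0)
    have hbd : ∀ w ∈ Set.Icc (-|z|) |z|,
        ‖partialZ g (x, y, w) - ∑ j ∈ Finset.range n, taylorZ (partialZ g) j x y * w ^ j‖
          ≤ C * |z| ^ n := by
      intro w hw
      refine (hball _ (hin w hw)).1.trans ?_
      rw [norm_pow, Real.norm_eq_abs]
      have := abs_le.2 hw
      gcongr
    have := (convex_Icc (-|z|) |z|).norm_image_sub_le_of_norm_hasDerivWithin_le hder hbd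
      (x := 0) (y := z) (by simp) (abs_le.1 le_rfl)
    have h0 : g (x, y, 0) - ∑ j ∈ Finset.range (n + 1), taylorZ g j x y * (0 : ℝ) ^ j = 0 := by
      simp [Finset.sum_range_succ', taylorZ]
    rw [h0, sub_zero, sub_zero] at this
    simpa [pow_succ, mul_assoc] using this

lemma eq_zero_of_mul_pow_isBigO {a : ℝ → ℝ} (ha : ContinuousAt a 0) {k : ℕ}
    (h : (fun t => a t * t ^ k) =O[𝓝 0] fun t => t ^ (k + 1)) : a 0 = 0 := by
  have h1 : a =O[𝓝[≠] 0] fun t => t := by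
    obtain ⟨C, hC⟩ := (h.mono (nhdsWithin_le_nhds (s := {0}ᶜ))).bound
    refine IsBigO.of_bound C ?_
    filter_upwards [hC, self_mem_nhdsWithin] with t ht ht0
    have hpos : 0 < ‖t ^ k‖ := norm_pos_iff.2 (pow_ne_zero _ ht0)
    rw [norm_mul, pow_succ, norm_mul] at ht
    exact le_of_mul_le_mul_right (by linarith) hpos
  exact tendsto_nhds_unique (ha.tendsto.mono_left nhdsWithin_le_nhds)
    (h1.trans_tendsto (tendsto_id.mono_left nhdsWithin_le_nhds))

lemma isBigO_slice_sub_taylorZ {g : ℝ × ℝ × ℝ → ℝ} {x y : ℝ} (hg : AnalyticAt ℝ g (x, y, 0))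
    (n : ℕ) :
    (fun t => g (x, y, t) - ∑ j ∈ Finset.range n, taylorZ g j x y * t ^ j)
      =O[𝓝 0] fun t => t ^ n := by
  have ht : Tendsto (fun t : ℝ => ((x, y, t) : ℝ × ℝ × ℝ)) (𝓝 0) (𝓝 (x, y, 0)) :=
    Continuous.tendsto (by fun_prop) 0
  exact (isBigO_sub_taylorZ hg n).comp_tendsto ht

lemma isBigO_slice_of_taylorZ_eq_zero {g : ℝ × ℝ × ℝ → ℝ} {x y : ℝ}
    (hg : AnalyticAt ℝ g (x, y, 0)) {n : ℕ} (h : ∀ j < n, taylorZ g j x y = 0) :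
    (fun t => g (x, y, t)) =O[𝓝 0] fun t => t ^ n := by
  refine (isBigO_slice_sub_taylorZ hg n).congr_left fun t => ?_
  rw [Finset.sum_eq_zero fun j hj => by rw [h j (Finset.mem_range.1 hj), zero_mul], sub_zero]

lemma isBigO_pow_of_le {m n : ℕ} (h : m ≤ n) :
    (fun t : ℝ => t ^ n) =O[𝓝 0] fun t => t ^ m := by
  obtain ⟨k, rfl⟩ := Nat.exists_eq_add_of_le h
  have : (fun t : ℝ => t ^ k) =O[𝓝 0] fun _ => (1 : ℝ) :=
    (continuous_pow k).continuousAt.norm.isBoundedUnder_le.isBigO_one ℝ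
  simpa [pow_add] using (isBigO_refl (fun t : ℝ => t ^ m) (𝓝 0)).mul this

lemma taylorZ_eq_zero_of_isBigO_slice {g : ℝ × ℝ × ℝ → ℝ} {x y : ℝ}
    (hg : AnalyticAt ℝ g (x, y, 0)) {n : ℕ}
    (h : (fun t => g (x, y, t)) =O[𝓝 0] fun t => t ^ n) {j : ℕ} (hj : j < n) :
    taylorZ g j x y = 0 := by
  induction j using Nat.strong_induction_on with
  | _ j ih =>
    have h1 := (h.trans (isBigO_pow_of_le (Nat.succ_le_of_lt hj))).sub
      (isBigO_slice_sub_taylorZ hg (j + 1))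
    refine eq_zero_of_mul_pow_isBigO (a := fun _ => taylorZ g j x y) (k := j)
      continuousAt_const (h1.congr_left fun t => ?_)
    rw [sub_sub_cancel, Finset.sum_range_succ, Finset.sum_eq_zero, zero_add]
    intro i hi
    have hi := Finset.mem_range.1 hi
    rw [ih i hi (hi.trans hj), zero_mul]

lemma eventually_slice_eq_zero_of_taylorZ_eq_zero {g : ℝ × ℝ × ℝ → ℝ} {x y : ℝ}
    (hg : AnalyticAt ℝ g (x, y, 0)) (h : ∀ j, taylorZ g j x y = 0) :
    ∀ᶠ t in 𝓝 0, g (x, y, t) = 0 := by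
  have ha : AnalyticAt ℝ (fun t : ℝ => g (x, y, t)) 0 :=
    AnalyticAt.comp_of_eq (g := g) (f := fun t : ℝ => ((x, y, t) : ℝ × ℝ × ℝ)) hg
      (by fun_prop) rfl
  by_contra hne
  obtain ⟨n, u, hu, hu0, he⟩ := ha.exists_eventuallyEq_pow_smul_nonzero_iff.2 hne
  refine hu0 (eq_zero_of_mul_pow_isBigO hu.continuousAt (k := n) ?_)
  refine (isBigO_slice_of_taylorZ_eq_zero hg (n := n + 1) fun j _ => h j).congr' ?_ .rfl
  filter_upwards [he] with t ht
  rw [ht, sub_zero, smul_eq_mul, mul_comm]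

lemma analyticAt_taylorZ {g : ℝ × ℝ × ℝ → ℝ} {x y : ℝ} (hg : AnalyticAt ℝ g (x, y, 0))
    (j : ℕ) : AnalyticAt ℝ (fun q : ℝ × ℝ => taylorZ g j q.1 q.2) (x, y) := by
  refine AnalyticAt.div_const ?_
  exact AnalyticAt.comp_of_eq (g := partialZ^[j] g)
    (f := fun q : ℝ × ℝ => ((q.1, q.2, 0) : ℝ × ℝ × ℝ)) (analyticAt_partialZ_iterate hg j)
      (analyticAt_fst.prod (analyticAt_snd.prod analyticAt_const)) rfl

/-- Part of parity `b` of the Taylor polynomial of `g` in the last variable, evaluated at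
`(x + t, y, t * w)` and divided by `w ^ b`, where `w ^ 2 = 1 - y ^ 2 - t ^ 2`. -/
noncomputable def parityTaylor (g : ℝ × ℝ × ℝ → ℝ) (b n : ℕ) (q : ℝ × ℝ × ℝ) : ℝ :=
  ∑ j ∈ Finset.range n with j % 2 = b,
    taylorZ g j (q.1 + q.2.2) q.2.1 * (1 - q.2.1 ^ 2 - q.2.2 ^ 2) ^ (j / 2) * q.2.2 ^ j

lemma analyticAt_parityTaylor {g : ℝ × ℝ × ℝ → ℝ} {x y : ℝ} (hg : AnalyticAt ℝ g (x, y, 0))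
    (b n : ℕ) : AnalyticAt ℝ (parityTaylor g b n) (x, y, 0) := by
  refine Finset.analyticAt_fun_sum _ fun j _ => ?_
  have h1 : AnalyticAt ℝ (fun q : ℝ × ℝ × ℝ => q.2.1) (x, y, 0) :=
    analyticAt_fst.comp analyticAt_snd
  have h2 : AnalyticAt ℝ (fun q : ℝ × ℝ × ℝ => q.2.2) (x, y, 0) :=
    analyticAt_snd.comp analyticAt_snd
  refine AnalyticAt.mul (AnalyticAt.mul ?_
    (((analyticAt_const.sub (h1.pow 2)).sub (h2.pow 2)).pow _)) (h2.pow j)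
  exact AnalyticAt.comp_of_eq (g := fun q : ℝ × ℝ => taylorZ g j q.1 q.2)
    (f := fun q : ℝ × ℝ × ℝ => ((q.1 + q.2.2, q.2.1) : ℝ × ℝ)) (analyticAt_taylorZ hg j)
      ((analyticAt_fst.add h2).prod h1) (by simp)

lemma sin_mem_S2 {y : ℝ} (hy : y ∈ Set.Ioo (-2) 2) :
    ((Real.sin (1 / (y + 2)), y, 0) : ℝ × ℝ × ℝ) ∈ S2 := by
  simp [S2, tfun, hy.1, hy.2]

lemma isBigO_parityTaylor {r : ℝ × ℝ × ℝ → ℝ} {x y : ℝ} (hr : AnalyticAt ℝ r (x, y, 0))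
    (hvanish : ∀ p ∈ S2, r p = 0) (hx : x = Real.sin (1 / (y + 2))) (hy : y ∈ Set.Ioo (-1) 1)
    {b : ℕ} (hb : b < 2) (n : ℕ) :
    (fun t => parityTaylor r b n (x, y, t)) =O[𝓝 0] fun t => t ^ n := by
  set w : ℝ → ℝ := fun t => √(1 - y ^ 2 - t ^ 2) with hw
  have hwc : Continuous w := by fun_prop
  have hy2 : 0 < 1 - y ^ 2 := by nlinarith [hy.1, hy.2]
  have hw0 : w 0 ≠ 0 := by
    simp only [hw]; exact (Real.sqrt_pos.2 (by simpa using hy2)).ne'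
  have hev : ∀ᶠ t : ℝ in 𝓝 0, 0 < 1 - y ^ 2 - t ^ 2 :=
    continuousAt_const.eventually_lt (f := fun _ : ℝ => (0 : ℝ))
      (g := fun t : ℝ => 1 - y ^ 2 - t ^ 2) (by fun_prop) (by simpa using hy2)
  have key : ∀ σ : ℝ, σ ^ 2 = 1 → (fun t => ∑ j ∈ Finset.range n,
      taylorZ r j (x + t) y * (σ * (t * w t)) ^ j) =O[𝓝 0] fun t => t ^ n := by
    intro σ hσ
    have ht : Tendsto (fun t : ℝ => ((x + t, y, σ * (t * w t)) : ℝ × ℝ × ℝ)) (𝓝 0)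
        (𝓝 (x, y, 0)) := by
      have : Continuous (fun t : ℝ => ((x + t, y, σ * (t * w t)) : ℝ × ℝ × ℝ)) := by fun_prop
      simpa using this.tendsto 0
    have h1 := (isBigO_sub_taylorZ hr n).comp_tendsto ht
    have h2 : (fun t => (σ * (t * w t)) ^ n) =O[𝓝 0] fun t => t ^ n := by
      have : (fun t => σ * w t) =O[𝓝 0] fun _ => (1 : ℝ) :=
        (Continuous.continuousAt (by fun_prop)).norm.isBoundedUnder_le.isBigO_one ℝ
      refine (((isBigO_refl (fun t : ℝ => t) (𝓝 0)).mul this).pow n).congr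
        (fun t => by ring) (fun t => by simp)
    refine ((h1.trans h2).neg_left).congr' ?_ .rfl
    filter_upwards [hev] with t ht
    have : r (x + t, y, σ * (t * w t)) = 0 := by
      refine hvanish _ ⟨by linarith [hy.1], by linarith [hy.2], ?_⟩
      have : w t ^ 2 = 1 - y ^ 2 - t ^ 2 := Real.sq_sqrt ht.le
      simp only [tfun, ← hx, mul_pow, hσ, this]
      ring
    simp [this]
  have h1 := (key 1 (by norm_num)).add ((key (-1) (by norm_num)).const_mul_left ((-1) ^ b))
  have h2 : (fun t => (2 * w t ^ b)⁻¹) =O[𝓝 0] fun _ => (1 : ℝ) :=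
    (ContinuousAt.inv₀ (by fun_prop) (by positivity)).norm.isBoundedUnder_le.isBigO_one ℝ
  refine (h2.mul h1).congr' ?_ (by simp)
  filter_upwards [hev] with t ht
  have hwt : w t ^ 2 = 1 - y ^ 2 - t ^ 2 := Real.sq_sqrt ht.le
  have hwt0 : w t ≠ 0 := (Real.sqrt_pos.2 ht).ne'
  rw [inv_mul_eq_iff_eq_mul₀ (by positivity), parityTaylor, Finset.sum_filter, Finset.mul_sum,
    Finset.mul_sum, ← Finset.sum_add_distrib]
  refine Finset.sum_congr rfl fun j _ => ?_
  have hj : w t ^ j = (1 - y ^ 2 - t ^ 2) ^ (j / 2) * w t ^ (j % 2) := by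
    rw [← hwt, ← pow_mul, ← pow_add, Nat.div_add_mod]
  have hs : (-1 : ℝ) ^ j = (-1) ^ (j % 2) := by
    conv_lhs => rw [← Nat.div_add_mod j 2, pow_add, pow_mul]
    simp
  simp only [mul_pow, hj, hs]
  have := Nat.mod_lt j two_pos
  interval_cases b <;> interval_cases j % 2 <;> simp <;> ring

lemma taylorZ_parityTaylor_eq_zero {Ω : Set (ℝ × ℝ × ℝ)} {r : ℝ × ℝ × ℝ → ℝ}
    (hr : AnalyticOnNhd ℝ r Ω) (hΩ : S2 ⊆ Ω) (hvanish : ∀ p ∈ S2, r p = 0)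
    {b : ℕ} (hb : b < 2) {n N : ℕ} (hN : N < n) {y : ℝ} (hy : y ∈ Set.Ioo (-2) 2) :
    taylorZ (parityTaylor r b n) N (Real.sin (1 / (y + 2))) y = 0 := by
  have hmem : ∀ y ∈ Set.Ioo (-2 : ℝ) 2, AnalyticAt ℝ r (Real.sin (1 / (y + 2)), y, 0) :=
    fun y hy => hr _ (hΩ (sin_mem_S2 hy))
  have ha : AnalyticOnNhd ℝ
      (fun y => taylorZ (parityTaylor r b n) N (Real.sin (1 / (y + 2))) y) (Set.Ioo (-2) 2) := by
    intro y hy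
    have hy0 : y + 2 ≠ 0 := by linarith [hy.1]
    refine AnalyticAt.comp_of_eq
      (g := fun q : ℝ × ℝ => taylorZ (parityTaylor r b n) N q.1 q.2)
      (f := fun y : ℝ => ((Real.sin (1 / (y + 2)), y) : ℝ × ℝ))
      (analyticAt_taylorZ (analyticAt_parityTaylor (hmem y hy) b n) N) ?_ rfl
    have hinv : AnalyticAt ℝ (fun y : ℝ => 1 / (y + 2)) y :=
      analyticAt_const.div (analyticAt_id.add analyticAt_const) hy0
    exact AnalyticAt.prod (AnalyticAt.comp (g := Real.sin) Real.analyticAt_sin hinv) analyticAt_id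
  refine ha.eqOn_zero_of_preconnected_of_eventuallyEq_zero (z₀ := 0) isPreconnected_Ioo
    (by norm_num) ?_ hy
  filter_upwards [Ioo_mem_nhds (show (-1 : ℝ) < 0 by norm_num) one_pos] with y hy
  have hr' := hmem y ⟨by linarith [hy.1], by linarith [hy.2]⟩
  exact taylorZ_eq_zero_of_isBigO_slice (analyticAt_parityTaylor hr' b n)
    (isBigO_parityTaylor hr' hvanish rfl hy hb n) hN

lemma frequently_sin_inv_eq {x : ℝ} (hx : x ∈ Set.Icc (-1) 1) :
    ∃ᶠ y in 𝓝[>] (-2 : ℝ), Real.sin (1 / (y + 2)) = x := by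
  have h1 : Tendsto (fun k : ℕ => Real.arcsin x + k * (2 * Real.pi)) atTop atTop :=
    tendsto_atTop_add_const_left _ _
      (tendsto_natCast_atTop_atTop.atTop_mul_const (by positivity))
  have h2 : Tendsto (fun k : ℕ => -2 + (Real.arcsin x + k * (2 * Real.pi))⁻¹) atTop
      (𝓝[>] (-2)) := by
    refine tendsto_nhdsWithin_iff.2 ⟨?_, ?_⟩
    · simpa using (tendsto_inv_atTop_zero.comp h1).const_add (-2)
    · filter_upwards [h1.eventually_gt_atTop 0] with k hk
      have := inv_pos.2 hk
      simpa using this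
  refine h2.frequently (Frequently.of_forall fun k => ?_)
  simp [Real.sin_add_nat_mul_two_pi, Real.sin_arcsin hx.1 hx.2]

lemma mem_closure_S2 : ((0, -2, 0) : ℝ × ℝ × ℝ) ∈ closure S2 := by
  rw [mem_closure_iff_frequently]
  have ht : Tendsto (fun y : ℝ => ((0, y, 0) : ℝ × ℝ × ℝ)) (𝓝[>] (-2)) (𝓝 (0, -2, 0)) :=
    (Continuous.tendsto (by fun_prop) (-2)).mono_left nhdsWithin_le_nhds
  refine ht.frequently (((frequently_sin_inv_eq (x := 0) (by simp)).and_eventually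
    (Ioo_mem_nhdsGT (show (-2 : ℝ) < 2 by norm_num))).mono ?_)
  rintro y ⟨h0, hy⟩
  simpa only [h0] using sin_mem_S2 hy

lemma taylorZ_eq_zero_of_box {Ω : Set (ℝ × ℝ × ℝ)} {r : ℝ × ℝ × ℝ → ℝ}
    (hr : AnalyticOnNhd ℝ r Ω) (hΩ : S2 ⊆ Ω) (hvanish : ∀ p ∈ S2, r p = 0) {ε : ℝ}
    (hε : 0 < ε) (hε1 : ε < 1)
    (hbox : ∀ x ∈ Set.Ioo (-ε) ε, ∀ y ∈ Set.Ioo (-2 - ε) (-2 + ε), (x, y, 0) ∈ Ω) (j : ℕ) :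
    ∀ x ∈ Set.Ioo (-ε) ε, ∀ y ∈ Set.Ioo (-2 - ε) (-2 + ε), taylorZ r j x y = 0 := by
  have hparity : ∀ b < 2, ∀ n, ∀ N < n, ∀ x ∈ Set.Ioo (-ε) ε,
      ∀ y ∈ Set.Ioo (-2 - ε) (-2 + ε), taylorZ (parityTaylor r b n) N x y = 0 := by
    intro b hb n N hN x hx y hy
    have ha : AnalyticOnNhd ℝ (fun y => taylorZ (parityTaylor r b n) N x y)
        (Set.Ioo (-2 - ε) (-2 + ε)) := fun y hy =>
      AnalyticAt.comp_of_eq (g := fun q : ℝ × ℝ => taylorZ (parityTaylor r b n) N q.1 q.2)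
        (f := fun y : ℝ => ((x, y) : ℝ × ℝ))
        (analyticAt_taylorZ (analyticAt_parityTaylor (hr _ (hbox x hx y hy)) b n) N)
        (by fun_prop) rfl
    refine ha.eqOn_zero_of_preconnected_of_frequently_eq_zero (z₀ := -2) isPreconnected_Ioo
      ⟨by linarith, by linarith⟩ ?_ hy
    have hf := (frequently_sin_inv_eq (x := x)
      ⟨by linarith [hx.1], by linarith [hx.2]⟩).and_eventually
      (Ioo_mem_nhdsGT (show (-2 : ℝ) < 2 by norm_num))
    refine (hf.mono ?_).filter_mono (nhdsWithin_mono _ fun y hy => ne_of_gt hy)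
    rintro y ⟨rfl, hy⟩
    exact taylorZ_parityTaylor_eq_zero hr hΩ hvanish hb hN hy
  induction j using Nat.strong_induction_on with
  | _ j ih =>
    intro x hx y hy
    have hxy := hr _ (hbox x hx y hy)
    have hO := isBigO_slice_of_taylorZ_eq_zero (analyticAt_parityTaylor hxy (j % 2) (j + 1))
      fun N hN => hparity (j % 2) (Nat.mod_lt j two_pos) (j + 1) N hN x hx y hy
    have hc : ContinuousAt (fun t => taylorZ r j (x + t) y * (1 - y ^ 2 - t ^ 2) ^ (j / 2)) 0 := by
      refine ContinuousAt.mul ?_ (by fun_prop)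
      exact ContinuousAt.comp_of_eq (g := fun q : ℝ × ℝ => taylorZ r j q.1 q.2)
        (f := fun t : ℝ => ((x + t, y) : ℝ × ℝ)) (analyticAt_taylorZ hxy j).continuousAt
        (by fun_prop) (by simp)
    have h0 := eq_zero_of_mul_pow_isBigO hc (k := j) (hO.congr' ?_ .rfl)
    · have hy1 : 1 - y ^ 2 - 0 ^ 2 ≠ 0 := by nlinarith [hy.1, hy.2]
      simpa only [add_zero, mul_eq_zero, pow_ne_zero _ hy1, or_false] using h0
    · have hx' : ∀ᶠ t in 𝓝 0, x + t ∈ Set.Ioo (-ε) ε :=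
        (Continuous.tendsto' (by fun_prop) 0 x (by simp) :
          Tendsto (fun t => x + t) (𝓝 0) (𝓝 x)).eventually (Ioo_mem_nhds hx.1 hx.2)
      filter_upwards [hx'] with t ht
      refine Finset.sum_eq_single_of_mem j (by simp) fun i hi hij => ?_
      have hi := Finset.mem_range.1 (Finset.mem_filter.1 hi).1
      rw [ih i (by omega) (x + t) ht y hy, zero_mul, zero_mul]

theorem stmt_0 (Ω : Set (ℝ × ℝ × ℝ)) (hΩopen : IsOpen Ω) (hΩconn : IsConnected Ω)
    (hΩsub : closure S2 ⊆ Ω) (r : ℝ × ℝ × ℝ → ℝ) (hr : AnalyticOn ℝ r Ω)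
    (hvanish : ∀ p ∈ S2, r p = 0) :
    ∀ p ∈ Ω, r p = 0 := by
  rw [hΩopen.analyticOn_iff_analyticOnNhd] at hr
  have hp₀ := hΩsub mem_closure_S2
  obtain ⟨δ, hδ, hball⟩ := Metric.isOpen_iff.1 hΩopen _ hp₀
  obtain ⟨ε, hε, hεlt⟩ := exists_between (lt_min hδ one_pos)
  obtain ⟨hεδ, hε1⟩ := lt_min_iff.1 hεlt
  have hbox : ∀ x ∈ Set.Ioo (-ε) ε, ∀ y ∈ Set.Ioo (-2 - ε) (-2 + ε), ∀ z ∈ Set.Ioo (-ε) ε,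
      (x, y, z) ∈ Ω := by
    intro x hx y hy z hz
    refine hball ?_
    simp only [Metric.mem_ball, Prod.dist_eq, max_lt_iff, Real.dist_eq, abs_lt]
    exact ⟨⟨by linarith [hx.1], by linarith [hx.2]⟩, ⟨by linarith [hy.1], by linarith [hy.2]⟩,
      by linarith [hz.1], by linarith [hz.2]⟩
  have h0 : (0 : ℝ) ∈ Set.Ioo (-ε) ε := ⟨by linarith, hε⟩
  have htaylor := taylorZ_eq_zero_of_box hr (subset_closure.trans hΩsub) hvanish hε hε1
    fun x hx y hy => hbox x hx y hy 0 h0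
  refine hr.eqOn_zero_of_preconnected_of_eventuallyEq_zero hΩconn.isPreconnected hp₀ ?_
  have hnhds : Set.Ioo (-ε) ε ×ˢ Set.Ioo (-2 - ε) (-2 + ε) ×ˢ Set.Ioo (-ε) ε ∈
      𝓝 ((0, -2, 0) : ℝ × ℝ × ℝ) :=
    prod_mem_nhds (Ioo_mem_nhds h0.1 h0.2)
      (prod_mem_nhds (Ioo_mem_nhds (by linarith) (by linarith)) (Ioo_mem_nhds h0.1 h0.2))
  filter_upwards [hnhds]
  rintro ⟨x, y, z⟩ ⟨hx, hy, hz⟩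
  have ha : AnalyticOnNhd ℝ (fun z => r (x, y, z)) (Set.Ioo (-ε) ε) := fun z hz =>
    AnalyticAt.comp_of_eq (g := r) (f := fun z : ℝ => ((x, y, z) : ℝ × ℝ × ℝ))
      (hr _ (hbox x hx y hy z hz)) (by fun_prop) rfl
  exact ha.eqOn_zero_of_preconnected_of_eventuallyEq_zero isPreconnected_Ioo h0
    (eventually_slice_eq_zero_of_taylorZ_eq_zero (hr _ (hbox x hx y hy 0 h0))
      fun j => htaylor j x hx y hy) hz
end

section
/- The closure of S₂ in ℝ³ equals S₂ ∪ {(x,-2,0) : -1 ≤ x ≤ 1} ∪ {(sin(1/4), 2, 0)}. In particular the closure of S₂ is a compact subset of ℝ³, and it is contained in S₃ = S₂ ∪ {z = 0}, so S₃ is closed in ℝ³. -/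
/-- `S₃ = S₂ ∪ {z = 0}`. -/
def S3 : Set (ℝ × ℝ × ℝ) := S2 ∪ {p | p.2.2 = 0}

open Filter Topology

lemma continuousAt_tfun {p : ℝ × ℝ × ℝ} (hp : -2 < p.2.1) :
    ContinuousAt (fun q : ℝ × ℝ × ℝ => tfun q.1 q.2.1) p := by
  have h : p.2.1 + 2 ≠ 0 := by linarith
  unfold tfun
  fun_prop (disch := exact h)

lemma S2_equation_of_mem_closure {p : ℝ × ℝ × ℝ} (hp : p ∈ closure S2) (hy : -2 < p.2.1) :
    p.2.2 ^ 2 = (1 - tfun p.1 p.2.1 ^ 2 - p.2.1 ^ 2) * tfun p.1 p.2.1 ^ 2 := by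
  obtain ⟨u, hu, hlim⟩ := mem_closure_iff_seq_limit.1 hp
  have ht := continuousAt_tfun hy
  have hl : ContinuousAt (fun q : ℝ × ℝ × ℝ => q.2.2 ^ 2) p := by fun_prop
  have hr : ContinuousAt (fun q : ℝ × ℝ × ℝ =>
      (1 - tfun q.1 q.2.1 ^ 2 - q.2.1 ^ 2) * tfun q.1 q.2.1 ^ 2) p := by fun_prop
  exact tendsto_nhds_unique (hl.tendsto.comp hlim)
    ((hr.tendsto.comp hlim).congr fun n => (hu n).2.2.symm)

lemma eq_zero_of_S2_equation {t y z : ℝ} (hy : 1 < y ^ 2)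
    (h : z ^ 2 = (1 - t ^ 2 - y ^ 2) * t ^ 2) : t = 0 ∧ z = 0 := by
  have ht : t = 0 := by
    by_contra hne
    have := pow_pos (abs_pos.2 hne) 2
    rw [sq_abs] at this
    nlinarith [sq_nonneg z, sq_nonneg (t ^ 2)]
  subst ht
  exact ⟨rfl, by simpa using h⟩

lemma S2_subset_box : S2 ⊆ Set.Icc (-2) 2 ×ˢ Set.Icc (-2) 2 ×ˢ Set.Icc (-1) 1 := by
  rintro ⟨x, y, z⟩ ⟨h₁, h₂, h⟩
  dsimp only at h₁ h₂ h
  have hs₁ := Real.neg_one_le_sin (1 / (y + 2))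
  have hs₂ := Real.sin_le_one (1 / (y + 2))
  have hx : x = tfun x y + Real.sin (1 / (y + 2)) := by simp [tfun]
  generalize tfun x y = t at *
  have ht : t ^ 2 ≤ 1 := by
    by_contra! hlt
    nlinarith [sq_nonneg z, sq_nonneg (t * y)]
  have hz : z ^ 2 ≤ 1 := by nlinarith [sq_nonneg (t ^ 2), sq_nonneg (t * y)]
  have ht' := abs_le.1 ((sq_le_one_iff_abs_le_one t).1 ht)
  have hz' := abs_le.1 ((sq_le_one_iff_abs_le_one z).1 hz)
  exact ⟨⟨by linarith, by linarith⟩, ⟨h₁.le, h₂.le⟩, hz'⟩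

lemma isCompact_closure_S2 : IsCompact (closure S2) :=
  (isCompact_Icc.prod (isCompact_Icc.prod isCompact_Icc)).closure_of_subset S2_subset_box

lemma sin_curve_mem_S2 {y : ℝ} (h₁ : -2 < y) (h₂ : y < 2) :
    (Real.sin (1 / (y + 2)), y, (0 : ℝ)) ∈ S2 :=
  ⟨h₁, h₂, by simp [tfun]⟩

lemma endpoint_mem_closure_S2 : (Real.sin (1 / 4), (2 : ℝ), (0 : ℝ)) ∈ closure S2 := by
  have hc : ContinuousAt (fun y : ℝ => (Real.sin (1 / (y + 2)), y, (0 : ℝ))) 2 := by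
    have h : (2 : ℝ) + 2 ≠ 0 := by norm_num
    fun_prop (disch := exact h)
  have hlim := hc.tendsto.mono_left (nhdsWithin_le_nhds (s := Set.Iio 2))
  norm_num only at hlim
  refine mem_closure_of_tendsto hlim ?_
  filter_upwards [Ioo_mem_nhdsLT (show (-2 : ℝ) < 2 by norm_num)] with y hy
  exact sin_curve_mem_S2 hy.1 hy.2

lemma segment_mem_closure_S2 {x : ℝ} (h₁ : -1 ≤ x) (h₂ : x ≤ 1) :
    (x, (-2 : ℝ), (0 : ℝ)) ∈ closure S2 := by
  let a : ℕ → ℝ := fun n => Real.arcsin x + (n + 1 : ℕ) * (2 * Real.pi)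
  have ha : ∀ n, 1 < a n := fun n => by
    have := Real.neg_pi_div_two_le_arcsin x
    have := Real.pi_gt_three
    have : (0 : ℝ) ≤ n * (2 * Real.pi) := by positivity
    simp only [a]
    push_cast
    linarith
  have hlim : Tendsto a atTop atTop :=
    tendsto_atTop_add_const_left _ _ <|
      (tendsto_natCast_atTop_atTop.comp (tendsto_add_atTop_nat 1)).atTop_mul_const
        Real.two_pi_pos
  have hy : Tendsto (fun n => -2 + (a n)⁻¹) atTop (𝓝 (-2)) := by
    simpa using (tendsto_inv_atTop_zero.comp hlim).const_add (-2)
  refine mem_closure_of_tendsto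
    (tendsto_const_nhds.prodMk_nhds (hy.prodMk_nhds tendsto_const_nhds))
    (Eventually.of_forall fun n => ?_)
  have hpos : 0 < (a n)⁻¹ := inv_pos.2 (by linarith [ha n])
  have hlt : (a n)⁻¹ < 1 := inv_lt_one_of_one_lt₀ (ha n)
  have hsin : Real.sin (1 / (-2 + (a n)⁻¹ + 2)) = x := by
    rw [show 1 / (-2 + (a n)⁻¹ + 2) = a n by simp]
    simp only [a, Real.sin_add_nat_mul_two_pi, Real.sin_arcsin h₁ h₂]
  have := sin_curve_mem_S2 (y := -2 + (a n)⁻¹) (by linarith) (by linarith)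
  rwa [hsin] at this

lemma closure_S2_eq :
    closure S2 =
      S2 ∪ {p : ℝ × ℝ × ℝ | -1 ≤ p.1 ∧ p.1 ≤ 1 ∧ p.2.1 = -2 ∧ p.2.2 = 0} ∪
        {(Real.sin (1 / 4), 2, 0)} := by
  apply Set.Subset.antisymm
  · intro p hp
    have hy : p.2.1 ∈ Set.Icc (-2 : ℝ) 2 :=
      (closure_minimal S2_subset_box
        (isClosed_Icc.prod (isClosed_Icc.prod isClosed_Icc)) hp).2.1
    rcases hy.1.eq_or_lt with hy₁ | hy₁
    · left; right
      obtain ⟨u, hu, hlim⟩ := mem_closure_iff_seq_limit.1 hp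
      have hev : ∀ᶠ n in atTop, u n ∈ {q : ℝ × ℝ × ℝ | -1 ≤ q.1 ∧ q.1 ≤ 1 ∧ q.2.2 = 0} := by
        have hlt : ∀ᶠ n in atTop, (u n).2.1 < -1 :=
          hlim.snd_nhds.fst_nhds.eventually_lt_const (by linarith)
        filter_upwards [hlt] with n hn
        obtain ⟨ht, hz⟩ := eq_zero_of_S2_equation (by nlinarith) (hu n).2.2
        have hx := sub_eq_zero.1 ht
        refine ⟨?_, ?_, hz⟩ <;> rw [hx]
        exacts [Real.neg_one_le_sin _, Real.sin_le_one _]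
      have hclosed : IsClosed {q : ℝ × ℝ × ℝ | -1 ≤ q.1 ∧ q.1 ≤ 1 ∧ q.2.2 = 0} :=
        (isClosed_le continuous_const continuous_fst).inter
          ((isClosed_le continuous_fst continuous_const).inter
            (isClosed_eq (continuous_snd.comp continuous_snd) continuous_const))
      obtain ⟨h₁, h₂, h₃⟩ := hclosed.mem_of_tendsto hlim hev
      exact ⟨h₁, h₂, hy₁.symm, h₃⟩
    · have heq := S2_equation_of_mem_closure hp hy₁
      rcases hy.2.eq_or_lt with hy₂ | hy₂
      · right
        obtain ⟨ht, hz⟩ := eq_zero_of_S2_equation (by rw [hy₂]; norm_num) heq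
        have hx := sub_eq_zero.1 ht
        rw [hy₂] at hx
        norm_num only at hx
        exact Prod.ext hx (Prod.ext hy₂ hz)
      · exact Or.inl (Or.inl ⟨hy₁, hy₂, heq⟩)
  · rintro p ((hp | hp) | hp)
    · exact subset_closure hp
    · obtain ⟨x, y, z⟩ := p
      obtain ⟨h₁, h₂, rfl, rfl⟩ := hp
      exact segment_mem_closure_S2 h₁ h₂
    · rw [Set.mem_singleton_iff.1 hp]
      exact endpoint_mem_closure_S2

lemma closure_S2_subset_S3 : closure S2 ⊆ S3 := by
  rw [closure_S2_eq]
  rintro p ((hp | hp) | hp)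
  · exact Or.inl hp
  · exact Or.inr hp.2.2.2
  · exact Or.inr (by rw [Set.mem_singleton_iff.1 hp]; rfl)

lemma isClosed_S3 : IsClosed S3 := by
  have h : S3 = closure S2 ∪ {p | p.2.2 = 0} :=
    (Set.union_subset_union_left _ subset_closure).antisymm
      (Set.union_subset closure_S2_subset_S3 Set.subset_union_right)
  rw [h]
  exact isClosed_closure.union (isClosed_eq (by fun_prop) (by fun_prop))

theorem stmt_2 :
    closure S2 =
      S2 ∪ {p : ℝ × ℝ × ℝ | -1 ≤ p.1 ∧ p.1 ≤ 1 ∧ p.2.1 = -2 ∧ p.2.2 = 0} ∪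
        {(Real.sin (1 / 4), 2, 0)} ∧
    IsCompact (closure S2) ∧ closure S2 ⊆ S3 ∧ IsClosed S3 :=
  ⟨closure_S2_eq, isCompact_closure_S2, closure_S2_subset_S3, isClosed_S3⟩
end

section
/- If (x,y,z) ∈ S₂ and |y| > 1 (so 1 < |y| < 2), then z = 0 and x = sin(1/(y+2)). That is, outside the slab {|y| ≤ 1} the set S₂ reduces to the curve {(sin(1/(y+2)), y, 0)}. -/
theorem stmt_3 (x y z : ℝ) (h : (x, y, z) ∈ S2) (hy : 1 < |y|) :
    z = 0 ∧ x = Real.sin (1 / (y + 2)) := by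
  obtain ⟨-, -, hz⟩ := h
  dsimp only at hz
  have hy2 : 1 < y ^ 2 := (one_lt_sq_iff_one_lt_abs y).mpr hy
  have ht : tfun x y = 0 := by
    by_contra hne
    have hpos : 0 < tfun x y ^ 2 := by positivity
    nlinarith [mul_pos (sub_pos.mpr hy2) hpos, sq_nonneg z, sq_nonneg (tfun x y ^ 2)]
  refine ⟨?_, sub_eq_zero.mp ht⟩
  simpa [ht] using hz
end

section
/- For all real numbers x and a with |x| ≤ 1/2 and |a| ≤ 1/2, and for every ε with 0 < ε < 1/10, there exists y with -2 < y < -2 + ε such that -a² = (1 - (x - sin(1/(y+2)))² - y²)·(x - sin(1/(y+2)))². In particular, for each such x and a the set of solutions y in (-2,-1) of this equation is infinite and accumulates at y = -2. -/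
/-- Every value in `[-1, 1]` is attained by the sine at arbitrarily large arguments. -/
lemma exists_lt_sin_eq (T : ℝ) {c : ℝ} (hc : c ∈ Set.Icc (-1 : ℝ) 1) :
    ∃ t, T < t ∧ Real.sin t = c := by
  obtain ⟨n, hn⟩ := exists_nat_gt (T - Real.arcsin c)
  refine ⟨Real.arcsin c + n * (2 * Real.pi), ?_, ?_⟩
  · nlinarith [Real.pi_gt_three, Nat.cast_nonneg (α := ℝ) n]
  · rw [Real.sin_add_nat_mul_two_pi, Real.sin_arcsin hc.1 hc.2]

/-- The level set equation has solutions in every right neighbourhood of `-2`. -/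
lemma exists_level_set_solution {x a ε : ℝ} (hx : |x| ≤ 1 / 2) (ha : |a| ≤ 1 / 2)
    (hε : 0 < ε) (hε' : ε < 1 / 10) :
    ∃ y : ℝ, -2 < y ∧ y < -2 + ε ∧
      -a ^ 2 = (1 - (x - Real.sin (1 / (y + 2))) ^ 2 - y ^ 2) *
        (x - Real.sin (1 / (y + 2))) ^ 2 := by
  rw [abs_le] at hx ha
  have hT : 0 < 1 / ε := by positivity
  have hinv : ∀ t, 1 / ε < t → 0 < 1 / t ∧ 1 / t < ε := fun t ht =>
    ⟨one_div_pos.2 (hT.trans ht), (one_div_lt hε (hT.trans ht)).1 ht⟩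
  obtain ⟨t₁, ht₁, hs₁⟩ := exists_lt_sin_eq (1 / ε) (c := x) ⟨by linarith, by linarith⟩
  obtain ⟨t₂, ht₂, hs₂⟩ : ∃ t, 1 / ε < t ∧ 1 ≤ (x - Real.sin t) ^ 2 := by
    rcases le_total x 0 with h | h
    · obtain ⟨t, ht, hs⟩ := exists_lt_sin_eq (1 / ε) (c := 1) (by norm_num)
      exact ⟨t, ht, by rw [hs]; nlinarith⟩
    · obtain ⟨t, ht, hs⟩ := exists_lt_sin_eq (1 / ε) (c := -1) (by norm_num)
      exact ⟨t, ht, by rw [hs]; nlinarith⟩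
  have hcont : ContinuousOn
      (fun t : ℝ => (1 - (x - Real.sin t) ^ 2 - (-2 + 1 / t) ^ 2) * (x - Real.sin t) ^ 2)
      (Set.Ioi (1 / ε)) := by
    have : ContinuousOn (fun t : ℝ => 1 / t) (Set.Ioi (1 / ε)) :=
      continuousOn_const.div continuousOn_id fun t ht => (hT.trans ht).ne'
    fun_prop
  obtain ⟨t, ht, heq⟩ := isPreconnected_Ioi.intermediate_value
    (Set.mem_Ioi.2 ht₂) (Set.mem_Ioi.2 ht₁) hcont (show -a ^ 2 ∈ Set.Icc _ _ by
      constructor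
      · obtain ⟨h₀, h₁⟩ := hinv t₂ ht₂
        have h : 1 - (x - Real.sin t₂) ^ 2 - (-2 + 1 / t₂) ^ 2 ≤ -1 := by nlinarith
        have ha' : a ^ 2 ≤ 1 := by nlinarith
        show (1 - (x - Real.sin t₂) ^ 2 - (-2 + 1 / t₂) ^ 2) * (x - Real.sin t₂) ^ 2 ≤ -a ^ 2
        nlinarith
      · simp [hs₁, sq_nonneg])
  obtain ⟨h₀, h₁⟩ := hinv t ht
  refine ⟨-2 + 1 / t, by linarith, by linarith, ?_⟩
  rw [neg_add_cancel_comm, one_div_one_div]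
  exact heq.symm

theorem stmt_5 (x a : ℝ) (hx : |x| ≤ 1 / 2) (ha : |a| ≤ 1 / 2) :
    (∀ ε : ℝ, 0 < ε → ε < 1 / 10 → ∃ y : ℝ, -2 < y ∧ y < -2 + ε ∧
      -a ^ 2 = (1 - (x - Real.sin (1 / (y + 2))) ^ 2 - y ^ 2) *
        (x - Real.sin (1 / (y + 2))) ^ 2) ∧
    Set.Infinite {y : ℝ | -2 < y ∧ y < -1 ∧
      -a ^ 2 = (1 - (x - Real.sin (1 / (y + 2))) ^ 2 - y ^ 2) *
        (x - Real.sin (1 / (y + 2))) ^ 2} := by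
  refine ⟨fun ε hε hε' => exists_level_set_solution hx ha hε hε', fun hfin => ?_⟩
  obtain ⟨y, hy, hy', heq⟩ :=
    exists_level_set_solution hx ha (ε := 1 / 20) (by norm_num) (by norm_num)
  obtain ⟨m, hm, hmin⟩ := Set.exists_min_image _ id hfin ⟨y, hy, by linarith, heq⟩
  obtain ⟨z, hz, hz', hzeq⟩ := exists_level_set_solution hx ha (ε := min (m + 2) (1 / 20))
    (lt_min (by linarith [hm.1]) (by norm_num)) ((min_le_right _ _).trans_lt (by norm_num))
  have hzm : z < m := by linarith [min_le_left (m + 2) (1 / 20 : ℝ)]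
  have hz1 : z < -1 := hzm.trans hm.2.1
  exact (hmin z ⟨hz, hz1, hzeq⟩).not_gt hzm
end

section
/- Let U ⊆ ℂ³ be a connected open set containing the point (0,-2,0), and let f : ℂ³ → ℂ be complex-analytic on U (AnalyticOn ℂ). Suppose there exists δ > 0 such that f(x, y, i·a) = 0 for all real numbers x, a, y with |x| < δ, |a| < δ, -2 < y < -1, (x,y,i·a) ∈ U, and -a² = (1 - (x - sin(1/(y+2)))² - y²)·(x - sin(1/(y+2)))². Then f is identically zero on U. -/
open Filter Topology

/-- A holomorphic function on a disc that vanishes at points `c + t * d` with arbitrarily small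
`t > 0` vanishes on the whole disc. -/
lemma eqOn_zero_ball_of_zeros_on_ray {g : ℂ → ℂ} {c d : ℂ} {r : ℝ} (hr : 0 < r)
    (hg : AnalyticOnNhd ℂ g (Metric.ball c r)) (hd : ‖d‖ = 1)
    (hz : ∀ ε : ℝ, 0 < ε → ∃ t : ℝ, 0 < t ∧ t < ε ∧ g (c + t * d) = 0) :
    ∀ z ∈ Metric.ball c r, g z = 0 := by
  have hfreq : ∃ᶠ z in 𝓝[≠] c, g z = 0 := by
    rw [(nhdsWithin_hasBasis Metric.nhds_basis_ball _).frequently_iff]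
    intro ε hε
    obtain ⟨t, ht, htε, h⟩ := hz ε hε
    have hd0 : d ≠ 0 := norm_ne_zero_iff.1 (by simp [hd])
    refine ⟨c + t * d, ⟨?_, ?_⟩, h⟩
    · simpa [dist_eq_norm, hd, abs_of_pos ht] using htε
    · simp [ht.ne', hd0]
  exact hg.eqOn_zero_of_preconnected_of_frequently_eq_zero (convex_ball c r).isPreconnected
    (Metric.mem_ball_self hr) hfreq

/-- The slice of the surface at fixed small `x` and `a` accumulates at `y = -2` from the right. -/
lemma exists_slice_point_near_neg_two {x a : ℝ} (hx : |x| < 1 / 2) (ha : |a| < 1 / 2) {ε : ℝ}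
    (hε : 0 < ε) :
    ∃ t : ℝ, 0 < t ∧ t < ε ∧
      -a ^ 2 = (1 - (x - Real.sin (1 / t)) ^ 2 - (-2 + t) ^ 2) *
        (x - Real.sin (1 / t)) ^ 2 := by
  obtain ⟨hx1, hx2⟩ := abs_lt.1 hx
  obtain ⟨ha1, ha2⟩ := abs_lt.1 ha
  obtain ⟨n, hn⟩ := exists_nat_gt (1 / ε + 4)
  have hε' : 0 < 1 / ε := by positivity
  have hπ := Real.pi_gt_three
  have hπ4 := Real.pi_le_four
  have hlow := Real.neg_pi_div_two_le_arcsin x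
  have hbase : 1 / ε + 2 < Real.arcsin x + n * (2 * Real.pi) := by
    have : (n : ℝ) * 1 ≤ n * (2 * Real.pi) := by gcongr; linarith
    linarith
  set l := Real.arcsin x + n * (2 * Real.pi) with hl
  set u := Real.pi / 2 + n * (2 * Real.pi) with hu
  have hlu : l ≤ u := by
    have := Real.arcsin_le_pi_div_two x
    linarith
  have hsl : Real.sin l = x := by
    rw [hl, Real.sin_add_nat_mul_two_pi, Real.sin_arcsin (by linarith) (by linarith)]
  have hsu : Real.sin u = 1 := by
    rw [hu, Real.sin_add_nat_mul_two_pi, Real.sin_pi_div_two]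
  let G : ℝ → ℝ := fun v =>
    ((x - Real.sin v) ^ 2 + (-2 + v⁻¹) ^ 2 - 1) * (x - Real.sin v) ^ 2
  have hG : ContinuousOn G (Set.Icc l u) := by
    have hinv : ContinuousOn (fun v : ℝ => v⁻¹) (Set.Icc l u) :=
      continuousOn_inv₀.mono fun v hv => by
        have : 0 < v := by linarith [hv.1]
        exact this.ne'
    fun_prop
  have hmem : a ^ 2 ∈ Set.Icc (G l) (G u) := by
    refine ⟨by simp [G, hsl, sq_nonneg], ?_⟩
    have hu2 : u⁻¹ ≤ 1 / 2 := by
      rw [one_div]; exact inv_anti₀ (by norm_num) (by linarith)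
    have h1 : (1 : ℝ) ≤ (x - 1) ^ 2 + (-2 + u⁻¹) ^ 2 - 1 := by nlinarith
    have h2 : (1 / 4 : ℝ) ≤ (x - 1) ^ 2 := by nlinarith
    simp only [G, hsu]
    nlinarith
  obtain ⟨v, hv, hGv⟩ := intermediate_value_Icc hlu hG hmem
  have hv1 : 1 / ε < v := by linarith [hv.1]
  have hv0 : 0 < v := hε'.trans hv1
  refine ⟨v⁻¹, inv_pos.2 hv0, ?_, ?_⟩
  · rw [one_div] at hv1
    exact inv_lt_of_inv_lt₀ hε hv1
  · rw [one_div, inv_inv, ← hGv]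
    ring

theorem stmt_6 (U : Set (ℂ × ℂ × ℂ)) (hUopen : IsOpen U) (hUconn : IsConnected U)
    (hmem : ((0 : ℂ), (-2 : ℂ), (0 : ℂ)) ∈ U) (f : ℂ × ℂ × ℂ → ℂ)
    (hf : AnalyticOn ℂ f U)
    (hvanish : ∃ δ : ℝ, 0 < δ ∧ ∀ x a y : ℝ, |x| < δ → |a| < δ →
      -2 < y → y < -1 → ((x : ℂ), (y : ℂ), Complex.I * (a : ℂ)) ∈ U →
      -a ^ 2 = (1 - (x - Real.sin (1 / (y + 2))) ^ 2 - y ^ 2) *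
        (x - Real.sin (1 / (y + 2))) ^ 2 →
      f ((x : ℂ), (y : ℂ), Complex.I * (a : ℂ)) = 0) :
    ∀ p ∈ U, f p = 0 := by
  obtain ⟨δ, hδ, hvan⟩ := hvanish
  have hfU : AnalyticOnNhd ℂ f U := hUopen.analyticOn_iff_analyticOnNhd.1 hf
  obtain ⟨ρ, hρ, hρU⟩ := Metric.isOpen_iff.1 hUopen _ hmem
  obtain ⟨r, hr, hrρ, hrδ, hr2⟩ : ∃ r : ℝ, 0 < r ∧ r ≤ ρ ∧ r ≤ δ ∧ r ≤ 1 / 2 :=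
    ⟨min ρ (min δ (1 / 2)), by positivity, min_le_left _ _,
      (min_le_right _ _).trans (min_le_left _ _), (min_le_right _ _).trans (min_le_right _ _)⟩
  have hU : ∀ z ∈ Metric.ball (0 : ℂ) r, ∀ w ∈ Metric.ball (-2 : ℂ) r,
      ∀ c ∈ Metric.ball (0 : ℂ) r, (z, w, c) ∈ U := by
    intro z hz w hw c hc
    apply hρU
    rw [Metric.mem_ball, Prod.dist_eq, Prod.dist_eq]
    exact max_lt (hz.out.trans_le hrρ) (max_lt (hw.out.trans_le hrρ) (hc.out.trans_le hrρ))
  have hreal : ∀ {x : ℝ}, |x| < r → (x : ℂ) ∈ Metric.ball (0 : ℂ) r := by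
    intro x hx
    simpa using hx
  have himag : ∀ {a : ℝ}, |a| < r → Complex.I * (a : ℂ) ∈ Metric.ball (0 : ℂ) r := by
    intro a ha
    simpa using ha
  have hy : ∀ x a : ℝ, |x| < r → |a| < r → ∀ w ∈ Metric.ball (-2 : ℂ) r,
      f ((x : ℂ), w, Complex.I * (a : ℂ)) = 0 := by
    intro x a hx ha
    refine eqOn_zero_ball_of_zeros_on_ray (g := fun w => f ((x : ℂ), w, Complex.I * (a : ℂ)))
      (d := 1) hr ?_ (by simp) ?_
    · intro w hw
      exact (hfU _ (hU _ (hreal hx) w hw _ (himag ha))).comp_of_eq (by fun_prop) rfl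
    · intro ε hε
      obtain ⟨t, ht, htε, heq⟩ := exists_slice_point_near_neg_two (hx.trans_le hr2)
        (ha.trans_le hr2) (lt_min hε hr)
      have htr : t < r := htε.trans_le (min_le_right _ _)
      refine ⟨t, ht, htε.trans_le (min_le_left _ _), ?_⟩
      have hcast : (-2 : ℂ) + t * 1 = ((-2 + t : ℝ) : ℂ) := by push_cast; ring
      rw [hcast]
      refine hvan x a (-2 + t) (hx.trans_le hrδ) (ha.trans_le hrδ) (by linarith) (by linarith)
        (hU _ (hreal hx) _ ?_ _ (himag ha)) ?_
      · rw [← hcast]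
        simpa [dist_eq_norm, abs_of_pos ht] using htr
      · rw [show -2 + t + 2 = t by ring]
        exact heq
  have hx : ∀ a : ℝ, |a| < r → ∀ w ∈ Metric.ball (-2 : ℂ) r, ∀ z ∈ Metric.ball (0 : ℂ) r,
      f (z, w, Complex.I * (a : ℂ)) = 0 := by
    intro a ha w hw
    refine eqOn_zero_ball_of_zeros_on_ray (g := fun z => f (z, w, Complex.I * (a : ℂ)))
      (d := 1) hr ?_ (by simp) ?_
    · intro z hz
      exact (hfU _ (hU z hz w hw _ (himag ha))).comp_of_eq (by fun_prop) rfl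
    · intro ε hε
      obtain ⟨t, ht, htε⟩ := exists_between (lt_min hε hr)
      refine ⟨t, ht, htε.trans_le (min_le_left _ _), ?_⟩
      have := hy t a (by rw [abs_of_pos ht]; exact htε.trans_le (min_le_right _ _)) ha w hw
      simpa using this
  have hz : ∀ z ∈ Metric.ball (0 : ℂ) r, ∀ w ∈ Metric.ball (-2 : ℂ) r,
      ∀ c ∈ Metric.ball (0 : ℂ) r, f (z, w, c) = 0 := by
    intro z hz w hw
    refine eqOn_zero_ball_of_zeros_on_ray (g := fun c => f (z, w, c))
      (d := Complex.I) hr ?_ (by simp) ?_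
    · intro c hc
      exact (hfU _ (hU z hz w hw c hc)).comp_of_eq (by fun_prop) rfl
    · intro ε hε
      obtain ⟨t, ht, htε⟩ := exists_between (lt_min hε hr)
      refine ⟨t, ht, htε.trans_le (min_le_left _ _), ?_⟩
      have := hx t (by rw [abs_of_pos ht]; exact htε.trans_le (min_le_right _ _)) w hw z hz
      simpa [mul_comm] using this
  refine hfU.eqOn_zero_of_preconnected_of_eventuallyEq_zero hUconn.isPreconnected hmem ?_
  filter_upwards [Metric.ball_mem_nhds _ hr] with p hp
  rw [Metric.mem_ball, Prod.dist_eq, Prod.dist_eq, max_lt_iff, max_lt_iff] at hp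
  exact hz p.1 hp.1 p.2.1 hp.2.1 p.2.2 hp.2.2
end

section
/- Let Ω ⊆ ℝ² be a connected open set containing a point (x₀, -2) with |x₀| < 1, and let r : ℝ² → ℝ be real-analytic on Ω (AnalyticOn ℝ). If r(sin(1/(y+2)), y) = 0 for every y ∈ (-2,-1) with (sin(1/(y+2)), y) ∈ Ω, then r is identically zero on Ω. -/
/-- The level set `{y | sin (1 / (y + 2)) = x}` accumulates at `-2` from the right. -/
theorem frequently_sin_one_div_add_two_eq {x : ℝ} (hx₁ : -1 ≤ x) (hx₂ : x ≤ 1) :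
    ∃ᶠ y in nhdsWithin (-2 : ℝ) (Set.Ioi (-2)), Real.sin (1 / (y + 2)) = x := by
  have hlim : Filter.Tendsto (fun n : ℕ => Real.arcsin x + n * (2 * Real.pi))
      Filter.atTop Filter.atTop :=
    Filter.tendsto_atTop_add_const_left _ _
      (tendsto_natCast_atTop_atTop.atTop_mul_const Real.two_pi_pos)
  have hinv : Filter.Tendsto (fun n : ℕ => (Real.arcsin x + n * (2 * Real.pi))⁻¹ - 2)
      Filter.atTop (nhdsWithin (-2 : ℝ) (Set.Ioi (-2))) := by
    refine tendsto_nhdsWithin_iff.2 ⟨?_, ?_⟩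
    · simpa using (tendsto_inv_atTop_zero.comp hlim).sub_const 2
    · filter_upwards [hlim.eventually_gt_atTop 0] with n hn
      have := inv_pos.2 hn
      simp only [Set.mem_Ioi]
      linarith
  refine hinv.frequently (Filter.Frequently.of_forall fun n => ?_)
  rw [sub_add_cancel, one_div, inv_inv, Real.sin_add_nat_mul_two_pi, Real.sin_arcsin hx₁ hx₂]

theorem stmt_7 (Ω : Set (ℝ × ℝ)) (hΩopen : IsOpen Ω) (hΩconn : IsConnected Ω)
    (x₀ : ℝ) (hx₀ : |x₀| < 1) (hmem : (x₀, (-2 : ℝ)) ∈ Ω)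
    (r : ℝ × ℝ → ℝ) (hr : AnalyticOn ℝ r Ω)
    (hvanish : ∀ y : ℝ, -2 < y → y < -1 →
      (Real.sin (1 / (y + 2)), y) ∈ Ω → r (Real.sin (1 / (y + 2)), y) = 0) :
    ∀ p ∈ Ω, r p = 0 := by
  have hr' : AnalyticOnNhd ℝ r Ω := hΩopen.analyticOn_iff_analyticOnNhd.1 hr
  refine hr'.eqOn_zero_of_preconnected_of_eventuallyEq_zero hΩconn.isPreconnected hmem ?_
  obtain ⟨ε, hε, hball⟩ := Metric.isOpen_iff.1 hΩopen _ hmem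
  rw [← ball_prod_same] at hball
  have hstrip : ∀ᶠ p : ℝ × ℝ in nhds (x₀, -2), |p.1| < 1 :=
    continuous_fst.abs.continuousAt.eventually_lt_const hx₀
  filter_upwards [hstrip, prod_mem_nhds (Metric.ball_mem_nhds x₀ hε)
    (Metric.ball_mem_nhds (-2 : ℝ) hε)]
  rintro ⟨x, y⟩ hx ⟨hxε, hyε⟩
  have hx' := abs_lt.1 hx
  have hslice : AnalyticOnNhd ℝ (fun t => r (x, t)) (Metric.ball (-2) ε) := fun t ht =>
    (hr' (x, t) (hball ⟨hxε, ht⟩)).comp (analyticAt_const.prod analyticAt_id)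
  refine hslice.eqOn_zero_of_preconnected_of_frequently_eq_zero
    (convex_ball _ _).isPreconnected (Metric.mem_ball_self hε) ?_ hyε
  have hnear : ∀ᶠ t in nhdsWithin (-2 : ℝ) (Set.Ioi (-2)),
      t ∈ Set.Ioi (-2 : ℝ) ∧ t < -1 ∧ t ∈ Metric.ball (-2 : ℝ) ε :=
    eventually_mem_nhdsWithin.and <| Filter.Eventually.filter_mono nhdsWithin_le_nhds <|
      (eventually_lt_nhds (by norm_num)).and (Metric.ball_mem_nhds _ hε)
  refine Filter.Frequently.filter_mono
    (((frequently_sin_one_div_add_two_eq hx'.1.le hx'.2.le).and_eventually hnear).mono ?_)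
    (nhdsWithin_mono _ fun t (ht : -2 < t) => ht.ne')
  rintro t ⟨hsin, ht, ht', htε⟩
  have hzero := hvanish t ht ht'
  rw [hsin] at hzero
  exact hzero (hball ⟨hxε, htε⟩)
end

section
/- The set Sing = {(x,y,0) ∈ ℝ³ : -1 ≤ y ≤ 1 and (1 - (x - sin(1/(y+2)))² - y²)·(x - sin(1/(y+2)))² = 0} is not a real-analytic subvariety of ℝ³. -/
/-- `X ⊆ ℝ³` is a real-analytic subvariety of `ℝ³` if it is closed and near
every point of `X` it is the zero set of a real-analytic function. -/
def IsRealAnalyticSubvariety (X : Set (ℝ × ℝ × ℝ)) : Prop :=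
  IsClosed X ∧ ∀ p ∈ X, ∃ U : Set (ℝ × ℝ × ℝ), IsOpen U ∧ p ∈ U ∧
    ∃ f : ℝ × ℝ × ℝ → ℝ, AnalyticOn ℝ f U ∧ X ∩ U = {q ∈ U | f q = 0}

/-- The singular set of `S₃`. -/
noncomputable def Sing : Set (ℝ × ℝ × ℝ) :=
  {p | p.2.2 = 0 ∧ -1 ≤ p.2.1 ∧ p.2.1 ≤ 1 ∧
    (1 - (p.1 - Real.sin (1 / (p.2.1 + 2))) ^ 2 - p.2.1 ^ 2) *
      (p.1 - Real.sin (1 / (p.2.1 + 2))) ^ 2 = 0}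

/-- A real-analytic function that vanishes at the points to the left of `a` near `a`
vanishes in a neighbourhood of `a`. -/
theorem AnalyticAt.eventually_eq_zero_of_nhdsLT {g : ℝ → ℝ} {a : ℝ} (hg : AnalyticAt ℝ g a)
    (h : ∀ᶠ t in nhdsWithin a (Set.Iio a), g t = 0) : ∀ᶠ t in nhds a, g t = 0 :=
  hg.frequently_zero_iff_eventually_zero.1
    (h.frequently.filter_mono (nhdsWithin_mono a fun _ ht => ne_of_lt ht))

theorem analyticAt_sin_one_div_add_two {a : ℝ} (ha : a + 2 ≠ 0) :
    AnalyticAt ℝ (fun t : ℝ => Real.sin (1 / (t + 2))) a :=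
  Real.analyticAt_sin.comp (analyticAt_const.div (analyticAt_id.add analyticAt_const) ha)

theorem stmt_9 : ¬ IsRealAnalyticSubvariety Sing := by
  rintro ⟨-, h⟩
  set c : ℝ → ℝ × ℝ × ℝ := fun t => (Real.sin (1 / (t + 2)), t, 0) with hc
  have hmem : ∀ t, -1 ≤ t → t ≤ 1 → c t ∈ Sing := fun t h₁ h₂ => by
    simp [Sing, hc, h₁, h₂]
  obtain ⟨U, hU, hpU, f, hf, hXU⟩ := h (c 1) (hmem 1 (by norm_num) le_rfl)
  have hca : AnalyticAt ℝ c 1 :=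
    (analyticAt_sin_one_div_add_two (by norm_num)).prod (analyticAt_id.prod analyticAt_const)
  have hcU : ∀ᶠ t in nhds 1, c t ∈ U := hca.continuousAt.eventually_mem (hU.mem_nhds hpU)
  have hfc : AnalyticAt ℝ (fun t => f (c t)) 1 :=
    ((hU.analyticOn_iff_analyticOnNhd.1 hf) _ hpU).comp hca
  have hleft : ∀ᶠ t in nhdsWithin (1 : ℝ) (Set.Iio 1), f (c t) = 0 := by
    filter_upwards [hcU.filter_mono nhdsWithin_le_nhds, self_mem_nhdsWithin,
      nhdsWithin_le_nhds (Ioi_mem_nhds (show (-1 : ℝ) < 1 by norm_num))] with t htU ht₁ ht₂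
    exact (hXU.subset ⟨hmem t (le_of_lt ht₂) (le_of_lt ht₁), htU⟩).2
  have hzero := hfc.eventually_eq_zero_of_nhdsLT hleft
  obtain ⟨t, ⟨htU, ht₀⟩, ht₁⟩ :=
    (((hcU.and hzero).filter_mono nhdsWithin_le_nhds).and
      (self_mem_nhdsWithin : Set.Ioi (1 : ℝ) ∈ nhdsWithin 1 (Set.Ioi 1))).exists
  have htS : c t ∈ Sing := (hXU.superset ⟨htU, ht₀⟩).1
  exact absurd htS.2.2.1 (not_le.2 ht₁)
end

section
/- S₃ is irreducible as a real-analytic subvariety of ℝ³: whenever X₁ and X₂ are real-analytic subvarieties of ℝ³ with X₁ ∪ X₂ = S₃, then X₁ = S₃ or X₂ = S₃. -/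
open Filter Topology

/-- Identity principle: an analytic map from a preconnected set that sends a neighbourhood of one
point into a real-analytic subvariety has all its values in the subvariety. -/
theorem IsRealAnalyticSubvariety.mem_of_eventually_mem {E : Type*} [NormedAddCommGroup E]
    [NormedSpace ℝ E] {X : Set (ℝ × ℝ × ℝ)} (hX : IsRealAnalyticSubvariety X) {M : Set E}
    (hM : IsPreconnected M) {γ : E → ℝ × ℝ × ℝ} (hγ : AnalyticOnNhd ℝ γ M) {a : E} (ha : a ∈ M)
    (hev : ∀ᶠ z in 𝓝 a, γ z ∈ X) {z : E} (hz : z ∈ M) : γ z ∈ X := by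
  have hsub : M ⊆ {w | ∀ᶠ z in 𝓝 w, γ z ∈ X} := by
    refine hM.subset_of_closure_inter_subset isOpen_setOfPred_eventually_nhds ⟨a, ha, hev⟩ ?_
    rintro p ⟨hp, hpM⟩
    have hpX : γ p ∈ X := by
      have hcl : p ∈ closure (γ ⁻¹' X) := closure_mono (fun w hw => hw.self_of_nhds) hp
      exact hX.1.closure_subset_iff.2 (Set.image_preimage_subset γ X)
        ((hγ p hpM).continuousAt.continuousWithinAt.mem_closure_image hcl)
    obtain ⟨U, hU, hpU, f, hf, hXU⟩ := hX.2 _ hpX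
    have hmem : ∀ q ∈ U, (q ∈ X ↔ f q = 0) := fun q hq =>
      ⟨fun h => (hXU.subset ⟨h, hq⟩).2, fun h => (hXU.superset ⟨hq, h⟩).1⟩
    rw [hU.analyticOn_iff_analyticOnNhd] at hf
    have hgood : ∀ᶠ w in 𝓝 p, γ w ∈ U ∧ AnalyticAt ℝ γ w :=
      ((hγ p hpM).continuousAt.eventually_mem (hU.mem_nhds hpU)).and
        (hγ p hpM).eventually_analyticAt
    obtain ⟨r, hr, hball⟩ := Metric.eventually_nhds_iff_ball.1 hgood
    obtain ⟨q, hq, hqX⟩ : (Metric.ball p r ∩ {w | ∀ᶠ z in 𝓝 w, γ z ∈ X}).Nonempty :=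
      mem_closure_iff_nhds.1 hp _ (Metric.ball_mem_nhds p hr)
    have han : AnalyticOnNhd ℝ (f ∘ γ) (Metric.ball p r) := fun w hw =>
      (hf _ (hball w hw).1).comp (hball w hw).2
    have hzero : (f ∘ γ) =ᶠ[𝓝 q] 0 := by
      filter_upwards [hqX, Metric.isOpen_ball.mem_nhds hq] with w hw hwb
      exact (hmem _ (hball w hwb).1).1 hw
    have hEq := han.eqOn_zero_of_preconnected_of_eventuallyEq_zero
      (convex_ball p r).isPreconnected hq hzero
    filter_upwards [Metric.ball_mem_nhds p hr] with w hw
    exact (hmem _ (hball w hw).1).2 (hEq hw)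
  exact (hsub hz).self_of_nhds

/-- The curve `t = z = 0`, parametrized by `y`. -/
noncomputable def axisCurve (y : ℝ) : ℝ × ℝ × ℝ := (Real.sin (1 / (y + 2)), y, 0)

/-- The part of `S₂` over `|y| ≤ 1`, parametrized by spherical coordinates `t = cos a cos b`,
`y = sin a`, `w = cos a sin b`, with `z = t w`. -/
noncomputable def lobes (p : ℝ × ℝ) : ℝ × ℝ × ℝ :=
  (Real.cos p.1 * Real.cos p.2 + Real.sin (1 / (Real.sin p.1 + 2)), Real.sin p.1,
    Real.cos p.1 * Real.cos p.2 * (Real.cos p.1 * Real.sin p.2))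

theorem analyticOnNhd_axisCurve : AnalyticOnNhd ℝ axisCurve (Set.Ioi (-2)) := by
  intro y hy
  have h : y + 2 ≠ 0 := by linarith [Set.mem_Ioi.1 hy]
  have hs : AnalyticAt ℝ (fun y : ℝ => Real.sin (1 / (y + 2))) y :=
    Real.analyticAt_sin.comp (analyticAt_const.div (analyticAt_id.add analyticAt_const) h)
  exact hs.prod (analyticAt_id.prod analyticAt_const)

theorem analyticOnNhd_lobes : AnalyticOnNhd ℝ lobes Set.univ := by
  intro p _
  have h : Real.sin p.1 + 2 ≠ 0 := by linarith [Real.neg_one_le_sin p.1]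
  have hs : AnalyticAt ℝ (fun p : ℝ × ℝ => Real.sin p.1) p :=
    Real.analyticAt_sin.comp analyticAt_fst
  have hc : AnalyticAt ℝ (fun p : ℝ × ℝ => Real.cos p.1) p :=
    Real.analyticAt_cos.comp analyticAt_fst
  have hs' : AnalyticAt ℝ (fun p : ℝ × ℝ => Real.sin p.2) p :=
    Real.analyticAt_sin.comp analyticAt_snd
  have hc' : AnalyticAt ℝ (fun p : ℝ × ℝ => Real.cos p.2) p :=
    Real.analyticAt_cos.comp analyticAt_snd
  have hsd : AnalyticAt ℝ (fun p : ℝ × ℝ => Real.sin (1 / (Real.sin p.1 + 2))) p :=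
    Real.analyticAt_sin.comp (analyticAt_const.div (hs.add analyticAt_const) h)
  exact ((hc.mul hc').add hsd).prod (hs.prod ((hc.mul hc').mul (hc.mul hs')))

theorem lobes_mem_S3 (p : ℝ × ℝ) : lobes p ∈ S3 := by
  refine Or.inl ⟨?_, ?_, ?_⟩
  · change -2 < Real.sin p.1
    linarith [Real.neg_one_le_sin p.1]
  · change Real.sin p.1 < 2
    linarith [Real.sin_le_one p.1]
  · simp only [lobes, tfun, add_sub_cancel_right]
    have h : 1 - (Real.cos p.1 * Real.cos p.2) ^ 2 - Real.sin p.1 ^ 2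
        = (Real.cos p.1 * Real.sin p.2) ^ 2 := by
      rw [mul_pow, mul_pow, Real.sin_sq p.1, Real.sin_sq p.2]
      ring
    rw [h]
    ring

theorem axisCurve_eq_lobes {y : ℝ} (h₁ : -1 ≤ y) (h₂ : y ≤ 1) :
    axisCurve y = lobes (Real.arcsin y, Real.pi / 2) := by
  simp [axisCurve, lobes, Real.sin_arcsin h₁ h₂]

theorem exists_lobes_eq {p : ℝ × ℝ × ℝ} (hp : p ∈ S2) (hz : p.2.2 ≠ 0) : ∃ q, lobes q = p := by
  obtain ⟨x, y, z⟩ := p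
  obtain ⟨-, -, h⟩ := hp
  simp only at h hz
  set t := tfun x y with ht
  have ht0 : t ≠ 0 := by
    rintro h0
    rw [h0] at h
    exact hz (by simpa using h)
  have hw : (z / t) ^ 2 = 1 - t ^ 2 - y ^ 2 := by
    rw [div_pow, h]
    field_simp
  have hy : y ^ 2 ≤ 1 := by nlinarith [sq_nonneg (z / t), sq_nonneg t]
  have hy' := abs_le.1 ((sq_le_one_iff_abs_le_one y).1 hy)
  set c : ℂ := ⟨t, z / t⟩ with hc
  have hnorm : Real.cos (Real.arcsin y) = ‖c‖ := by
    rw [Real.cos_arcsin, Complex.norm_def, Complex.normSq_apply]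
    congr 1
    simp only [hc]
    linarith
  refine ⟨(Real.arcsin y, c.arg), ?_⟩
  simp only [lobes, hnorm, Complex.norm_mul_cos_arg, Complex.norm_mul_sin_arg,
    Real.sin_arcsin hy'.1 hy'.2]
  refine Prod.ext ?_ (Prod.ext rfl ?_)
  · simp [hc, ht, tfun]
  · simp only [hc]
    field_simp

/-- The oscillation of the curve at `y = -2` forces the whole plane into the subvariety. -/
theorem IsRealAnalyticSubvariety.plane_subset_of_axisCurve_mem {X : Set (ℝ × ℝ × ℝ)}
    (hX : IsRealAnalyticSubvariety X) (h : ∀ y : ℝ, -2 < y → axisCurve y ∈ X) (x y : ℝ) :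
    (x, y, (0 : ℝ)) ∈ X := by
  set u : ℝ → ℕ → ℝ := fun x n => -2 + 1 / (Real.arcsin x + n * (2 * Real.pi)) with hu
  have hatTop : ∀ x : ℝ, Tendsto (fun n : ℕ => Real.arcsin x + n * (2 * Real.pi)) atTop atTop :=
    fun x => tendsto_atTop_add_const_left _ _
      (tendsto_natCast_atTop_atTop.atTop_mul_const Real.two_pi_pos)
  have hlim : ∀ x, Tendsto (u x) atTop (𝓝 (-2)) := fun x => by
    simpa [hu] using (tendsto_inv_atTop_zero.comp (hatTop x)).const_add (-2 : ℝ)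
  have hgt : ∀ x, ∀ᶠ n in atTop, -2 < u x n := fun x => by
    filter_upwards [(hatTop x).eventually_gt_atTop 0] with n hn
    have := one_div_pos.2 hn
    simp only [hu]
    linarith
  have hmemX : ∀ x, -1 ≤ x → x ≤ 1 → ∀ᶠ n in atTop, (x, u x n, (0 : ℝ)) ∈ X := by
    intro x h₁ h₂
    filter_upwards [hgt x] with n hn
    have := h _ hn
    rwa [axisCurve, show u x n + 2 = 1 / (Real.arcsin x + n * (2 * Real.pi)) by simp [hu],
      one_div_one_div, Real.sin_add_nat_mul_two_pi, Real.sin_arcsin h₁ h₂] at this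
  have hcentre : ((0 : ℝ), (-2 : ℝ), (0 : ℝ)) ∈ X :=
    hX.1.mem_of_tendsto (tendsto_const_nhds.prodMk_nhds ((hlim 0).prodMk_nhds tendsto_const_nhds))
      (hmemX 0 (by norm_num) (by norm_num))
  obtain ⟨U, hU, hpU, f, hf, hXU⟩ := hX.2 _ hcentre
  rw [hU.analyticOn_iff_analyticOnNhd] at hf
  have hplane : ∀ q : ℝ × ℝ, AnalyticAt ℝ (fun q : ℝ × ℝ => (q.1, q.2, (0 : ℝ))) q := fun q =>
    analyticAt_fst.prod (analyticAt_snd.prod analyticAt_const)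
  have hnear : ∀ᶠ q : ℝ × ℝ in 𝓝 (0, -2), (q.1, q.2, (0 : ℝ)) ∈ U :=
    (hplane (0, -2)).continuousAt.eventually_mem (hU.mem_nhds hpU)
  obtain ⟨r, hr, hball⟩ := Metric.eventually_nhds_iff_ball.1 hnear
  have hbox : ∀ x ∈ Metric.ball (0 : ℝ) r, ∀ y ∈ Metric.ball (-2 : ℝ) r, (x, y, (0 : ℝ)) ∈ U :=
    fun x hx y hy => hball (x, y) (by rw [← ball_prod_same]; exact ⟨hx, hy⟩)
  have hev : ∀ᶠ q : ℝ × ℝ in 𝓝 (0, -2), (q.1, q.2, (0 : ℝ)) ∈ X := by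
    have hmin : 0 < min r 1 := lt_min hr one_pos
    filter_upwards [prod_mem_nhds (Metric.ball_mem_nhds (0 : ℝ) hmin)
      (Metric.ball_mem_nhds (-2 : ℝ) hr)]
    rintro ⟨x, y⟩ ⟨hx, hy⟩
    have hxr : x ∈ Metric.ball (0 : ℝ) r := Metric.ball_subset_ball (min_le_left _ _) hx
    have hx1 : |x| < 1 := by
      simpa using Metric.ball_subset_ball (min_le_right r 1) hx
    obtain ⟨h₁, h₂⟩ := abs_lt.1 hx1
    have han : AnalyticOnNhd ℝ (fun y => f (x, y, 0)) (Metric.ball (-2) r) := fun y hy =>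
      (hf _ (hbox x hxr y hy)).comp_of_eq
        (analyticAt_const.prod (analyticAt_id.prod analyticAt_const)) rfl
    have hfreq : ∃ᶠ y in 𝓝[≠] (-2 : ℝ), f (x, y, 0) = 0 := by
      have hl : Tendsto (u x) atTop (𝓝[≠] (-2)) :=
        tendsto_nhdsWithin_iff.2 ⟨hlim x, (hgt x).mono fun n hn => hn.ne'⟩
      refine hl.frequently (Eventually.frequently ?_)
      filter_upwards [hmemX x h₁.le h₂.le,
        (hlim x).eventually (Metric.ball_mem_nhds (-2 : ℝ) hr)] with n hn hnr
      exact (hXU.subset ⟨hn, hbox x hxr _ hnr⟩).2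
    have hzero := han.eqOn_zero_of_preconnected_of_frequently_eq_zero
      (convex_ball (-2 : ℝ) r).isPreconnected (Metric.mem_ball_self hr) hfreq hy
    exact (hXU.superset ⟨hbox x hxr y hy, hzero⟩).1
  exact hX.mem_of_eventually_mem (z := (x, y)) isPreconnected_univ (fun q _ => hplane q)
    (Set.mem_univ _) hev (Set.mem_univ _)

theorem IsRealAnalyticSubvariety.S3_subset_of_lobes_mem {X : Set (ℝ × ℝ × ℝ)}
    (hX : IsRealAnalyticSubvariety X) (h : ∀ p, lobes p ∈ X) : S3 ⊆ X := by
  have hcurve : ∀ y : ℝ, -2 < y → axisCurve y ∈ X := fun y hy => by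
    refine hX.mem_of_eventually_mem (convex_Ioi (-2 : ℝ)).isPreconnected analyticOnNhd_axisCurve
      (a := 0) (by norm_num) ?_ hy
    filter_upwards [Icc_mem_nhds (show (-1 : ℝ) < 0 by norm_num) one_pos] with y hy
    rw [axisCurve_eq_lobes hy.1 hy.2]
    exact h _
  have hplane : ∀ p : ℝ × ℝ × ℝ, p.2.2 = 0 → p ∈ X := by
    rintro ⟨x, y, z⟩ rfl
    exact hX.plane_subset_of_axisCurve_mem hcurve x y
  rintro p (hp | hp)
  · by_cases hz : p.2.2 = 0
    · exact hplane p hz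
    · obtain ⟨q, rfl⟩ := exists_lobes_eq hp hz
      exact h q
  · exact hplane p hp

theorem stmt_10 (X₁ X₂ : Set (ℝ × ℝ × ℝ))
    (h₁ : IsRealAnalyticSubvariety X₁) (h₂ : IsRealAnalyticSubvariety X₂)
    (hunion : X₁ ∪ X₂ = S3) :
    X₁ = S3 ∨ X₂ = S3 := by
  by_cases h : ∀ p, lobes p ∈ X₁
  · exact Or.inl ((hunion ▸ Set.subset_union_left).antisymm (h₁.S3_subset_of_lobes_mem h))
  · obtain ⟨a, ha⟩ := not_forall.1 h
    have hev : ∀ᶠ p in 𝓝 a, lobes p ∈ X₂ := by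
      filter_upwards [(analyticOnNhd_lobes a trivial).continuousAt.eventually_mem
        (h₁.1.isOpen_compl.mem_nhds ha)] with p hp
      exact (hunion.superset (lobes_mem_S3 p)).resolve_left hp
    exact Or.inr ((hunion ▸ Set.subset_union_right).antisymm (h₂.S3_subset_of_lobes_mem fun p =>
      h₂.mem_of_eventually_mem isPreconnected_univ analyticOnNhd_lobes trivial hev trivial))
end

section
/- S₁ is irreducible as a real-analytic subvariety of ℝ³: whenever X₁ and X₂ are real-analytic subvarieties of ℝ³ with X₁ ∪ X₂ = S₁, then X₁ = S₁ or X₂ = S₁. -/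
/-- The pinched sphere `S₁ = {z² = (1 - x² - y²)·x²}`. -/
def S1 : Set (ℝ × ℝ × ℝ) :=
  {p | p.2.2 ^ 2 = (1 - p.1 ^ 2 - p.2.1 ^ 2) * p.1 ^ 2}

/-- The pullback of a real-analytic subvariety along an analytic map defined on a whole normed
space is everything as soon as it has nonempty interior. -/
theorem IsRealAnalyticSubvariety.preimage_eq_univ {E : Type*} [NormedAddCommGroup E]
    [NormedSpace ℝ E] {X : Set (ℝ × ℝ × ℝ)} (hX : IsRealAnalyticSubvariety X)
    {φ : E → ℝ × ℝ × ℝ} (hφ : AnalyticOnNhd ℝ φ Set.univ)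
    (hne : (interior (φ ⁻¹' X)).Nonempty) : φ ⁻¹' X = Set.univ := by
  have hc : Continuous φ := continuousOn_univ.mp hφ.continuousOn
  have hclosed : IsClosed (interior (φ ⁻¹' X)) := by
    refine isClosed_of_closure_subset fun p hp => ?_
    have hpX : φ p ∈ X :=
      (hX.1.preimage hc).closure_subset_iff.mpr interior_subset hp
    obtain ⟨U, hU, hpU, f, hf, hfU⟩ := hX.2 _ hpX
    obtain ⟨ε, hε, hB⟩ := Metric.isOpen_iff.mp (hU.preimage hc) p hpU
    have hfφ : AnalyticOnNhd ℝ (f ∘ φ) (Metric.ball p ε) := fun x hx =>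
      ((hU.analyticOn_iff_analyticOnNhd.mp hf) (φ x) (hB hx)).comp (hφ x trivial)
    obtain ⟨q, hqB, hqA⟩ :=
      mem_closure_iff.mp hp _ Metric.isOpen_ball (Metric.mem_ball_self hε)
    have hev : f ∘ φ =ᶠ[nhds q] 0 := by
      filter_upwards [isOpen_interior.mem_nhds hqA, Metric.isOpen_ball.mem_nhds hqB]
        with x hx hxB
      have hxX : x ∈ φ ⁻¹' X := interior_subset hx
      exact (hfU.subset ⟨hxX, hB hxB⟩).2
    have hzero := hfφ.eqOn_zero_of_preconnected_of_eventuallyEq_zero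
      (convex_ball p ε).isPreconnected hqB hev
    exact mem_interior.mpr ⟨Metric.ball p ε,
      fun x hx => (hfU.superset ⟨hB hx, hzero hx⟩).1,
      Metric.isOpen_ball, Metric.mem_ball_self hε⟩
  have huniv : interior (φ ⁻¹' X) = Set.univ := IsClopen.eq_univ ⟨hclosed, isOpen_interior⟩ hne
  exact Set.eq_univ_of_univ_subset (huniv ▸ interior_subset)

/-- Spherical coordinates on the two-dimensional part of `S1`. -/
noncomputable def pinchedSphereParam (p : ℝ × ℝ) : ℝ × ℝ × ℝ :=
  (Real.cos p.1 * Real.cos p.2, Real.cos p.1 * Real.sin p.2,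
    Real.cos p.1 * Real.cos p.2 * Real.sin p.1)

theorem analyticOnNhd_pinchedSphereParam : AnalyticOnNhd ℝ pinchedSphereParam Set.univ := by
  intro p _
  have hc₁ : AnalyticAt ℝ (fun p : ℝ × ℝ => Real.cos p.1) p :=
    Real.analyticAt_cos.comp analyticAt_fst
  have hs₁ : AnalyticAt ℝ (fun p : ℝ × ℝ => Real.sin p.1) p :=
    Real.analyticAt_sin.comp analyticAt_fst
  have hc₂ : AnalyticAt ℝ (fun p : ℝ × ℝ => Real.cos p.2) p :=
    Real.analyticAt_cos.comp analyticAt_snd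
  have hs₂ : AnalyticAt ℝ (fun p : ℝ × ℝ => Real.sin p.2) p :=
    Real.analyticAt_sin.comp analyticAt_snd
  exact (hc₁.mul hc₂).prod ((hc₁.mul hs₂).prod ((hc₁.mul hc₂).mul hs₁))

theorem pinchedSphereParam_mem_S1 (p : ℝ × ℝ) : pinchedSphereParam p ∈ S1 := by
  simp only [S1, pinchedSphereParam, Set.mem_ofPred_eq]
  rw [mul_pow _ (Real.sin p.1), mul_comm]
  congr 1
  linear_combination (Real.cos p.1) ^ 2 * Real.sin_sq_add_cos_sq p.2 +
    Real.sin_sq_add_cos_sq p.1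

theorem exists_pinchedSphereParam_eq {x y z : ℝ} (h : (x, y, z) ∈ S1) (hx : x ≠ 0) :
    ∃ p, pinchedSphereParam p = (x, y, z) := by
  simp only [S1, Set.mem_ofPred_eq] at h
  have hw : (z / x) ^ 2 = 1 - x ^ 2 - y ^ 2 := by
    rw [div_pow, h]
    field_simp
  have hw1 : |z / x| ≤ 1 := by
    rw [← sq_le_one_iff_abs_le_one]
    nlinarith [sq_nonneg x, sq_nonneg y]
  have hcos : Real.cos (Real.arcsin (z / x)) = ‖(⟨x, y⟩ : ℂ)‖ := by
    rw [Real.cos_arcsin, hw, Complex.norm_def, Complex.normSq_mk]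
    ring_nf
  refine ⟨(Real.arcsin (z / x), Complex.arg ⟨x, y⟩), ?_⟩
  simp only [pinchedSphereParam]
  rw [hcos, Complex.norm_mul_cos_arg, Complex.norm_mul_sin_arg,
    Real.sin_arcsin (abs_le.mp hw1).1 (abs_le.mp hw1).2]
  simp [mul_div_cancel₀, hx]

theorem IsRealAnalyticSubvariety.S1_subset {X : Set (ℝ × ℝ × ℝ)}
    (hX : IsRealAnalyticSubvariety X) (h : pinchedSphereParam ⁻¹' X = Set.univ) : S1 ⊆ X := by
  have hmem (p : ℝ × ℝ) : pinchedSphereParam p ∈ X := Set.eq_univ_iff_forall.mp h p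
  rintro ⟨x, y, z⟩ hp
  by_cases hx : x = 0
  · subst hx
    obtain rfl : z = 0 := by simpa [S1] using hp
    have hψ : AnalyticOnNhd ℝ (fun t : ℝ => ((0 : ℝ), t, (0 : ℝ))) Set.univ := fun t _ =>
      analyticAt_const.prod (analyticAt_id.prod analyticAt_const)
    have hline := hX.preimage_eq_univ hψ
      ⟨0, mem_interior.mpr ⟨Set.Ioo (-1) 1, fun t ht => ?_, isOpen_Ioo, by norm_num⟩⟩
    · exact Set.eq_univ_iff_forall.mp hline y
    · simpa [pinchedSphereParam, Real.cos_arccos ht.1.le ht.2.le] using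
        hmem (Real.arccos t, Real.pi / 2)
  · obtain ⟨p, hp⟩ := exists_pinchedSphereParam_eq hp hx
    exact hp ▸ hmem p

theorem stmt_12 (X₁ X₂ : Set (ℝ × ℝ × ℝ))
    (h₁ : IsRealAnalyticSubvariety X₁) (h₂ : IsRealAnalyticSubvariety X₂)
    (hunion : X₁ ∪ X₂ = S1) :
    X₁ = S1 ∨ X₂ = S1 := by
  have hcover (p : ℝ × ℝ) : pinchedSphereParam p ∈ X₁ ∪ X₂ :=
    hunion ▸ pinchedSphereParam_mem_S1 p
  by_cases hne : (interior (pinchedSphereParam ⁻¹' X₁)).Nonempty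
  · exact .inl <| (hunion ▸ Set.subset_union_left).antisymm
      (h₁.S1_subset (h₁.preimage_eq_univ analyticOnNhd_pinchedSphereParam hne))
  · refine .inr <| (hunion ▸ Set.subset_union_right).antisymm (h₂.S1_subset ?_)
    have hc : Continuous pinchedSphereParam :=
      continuousOn_univ.mp analyticOnNhd_pinchedSphereParam.continuousOn
    have hdense : Dense (pinchedSphereParam ⁻¹' X₁)ᶜ :=
      interior_eq_empty_iff_dense_compl.mp (Set.not_nonempty_iff_eq_empty.mp hne)
    rw [← (h₂.1.preimage hc).closure_eq]
    exact (hdense.mono fun p hp => (hcover p).resolve_left hp).closure_eq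
end

section
/- For every y₀ with -1 < y₀ < 1, the set S₃ is not locally Euclidean of dimension two at the point p = (sin(1/(y₀+2)), y₀, 0): no open neighbourhood of p in S₃ (with the subspace topology from ℝ³) is homeomorphic to an open subset of ℝ². -/
open Complex Set Metric

/-- `f` restricted to `[0, 2π]` is a loop in `ℂ \ {0}` with winding number `n` around `0`. -/
def HasWinding (f : ℝ → ℂ) (n : ℤ) : Prop :=
  ∃ g : ℝ → ℂ, Continuous g ∧ (∀ θ, exp (g θ) = f θ) ∧
    g (2 * Real.pi) = g 0 + n * (2 * Real.pi * I)

lemma IsPreconnected.sub_eq_sub_of_exp_eq {X : Type*} [TopologicalSpace X] {S : Set X}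
    (hS : IsPreconnected S) {u v : X → ℂ} (hu : ContinuousOn u S) (hv : ContinuousOn v S)
    (h : ∀ x ∈ S, exp (u x) = exp (v x)) {x y : X} (hx : x ∈ S) (hy : y ∈ S) :
    u x - v x = u y - v y := by
  have hsub : (fun x ↦ u x - v x) '' S ⊆ range fun n : ℤ ↦ (n : ℂ) * (2 * Real.pi * I) := by
    rintro _ ⟨z, hz, rfl⟩
    obtain ⟨n, hn⟩ := exp_eq_exp_iff_exists_int.1 (h z hz)
    exact ⟨n, by simp [hn]⟩
  have hcount := (countable_range _).mono hsub
  exact hcount.isTotallyDisconnected _ subset_rfl (hS.image _ (hu.sub hv))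
    (mem_image_of_mem _ hx) (mem_image_of_mem _ hy)

lemma HasWinding.unique {f : ℝ → ℂ} {m n : ℤ} (hm : HasWinding f m) (hn : HasWinding f n) :
    m = n := by
  obtain ⟨u, hu, huf, hum⟩ := hm
  obtain ⟨v, hv, hvf, hvn⟩ := hn
  have h := isPreconnected_univ.sub_eq_sub_of_exp_eq hu.continuousOn hv.continuousOn
    (fun x _ ↦ (huf x).trans (hvf x).symm) (mem_univ (2 * Real.pi)) (mem_univ 0)
  rw [hum, hvn] at h
  have h' : ((m : ℂ) - n) * (2 * Real.pi * I) = 0 := by linear_combination h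
  have := (mul_eq_zero.1 h').resolve_right two_pi_I_ne_zero
  exact_mod_cast sub_eq_zero.1 this

lemma Convex.isSimplyConnected {E : Type*} [NormedAddCommGroup E] [NormedSpace ℝ E] {s : Set E}
    (hs : Convex ℝ s) (hne : s.Nonempty) : IsSimplyConnected s := by
  have := hs.contractibleSpace hne
  exact SimplyConnectedSpace.ofContractible s

lemma exists_hasWinding {f : ℝ → ℂ} (hf : Continuous f) (h0 : ∀ θ, f θ ≠ 0)
    (hper : f (2 * Real.pi) = f 0) : ∃ n, HasWinding f n := by
  obtain ⟨g, hg, hgf⟩ := exists_continuousOn_eqOn_exp_comp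
    (convex_univ.isSimplyConnected univ_nonempty) isOpen_univ hf.continuousOn
    (by simpa using h0)
  have hgf' θ : exp (g θ) = f θ := hgf (mem_univ θ)
  obtain ⟨n, hn⟩ := exp_eq_exp_iff_exists_int.1
    (((hgf' (2 * Real.pi)).trans hper).trans (hgf' 0).symm)
  exact ⟨n, g, continuousOn_univ.1 hg, hgf', hn⟩

/-- A nonvanishing function on a punctured disc multiplies winding numbers by its degree. -/
lemma exists_hasWinding_comp {F : ℂ → ℂ} {q : ℂ} {r : ℝ} (hr : 0 < r)
    (hF : ContinuousOn F (ball q r \ {q})) (h0 : ∀ w ∈ ball q r \ {q}, F w ≠ 0) :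
    ∃ c : ℤ, ∀ (f : ℝ → ℂ) (n : ℤ), (∀ θ, f θ ∈ ball q r) →
      HasWinding (fun θ ↦ f θ - q) n → HasWinding (fun θ ↦ F (f θ)) (c * n) := by
  set H : Set ℂ := {w | w.re < Real.log r} with hH
  have hmem w : w ∈ H ↔ q + exp w ∈ ball q r \ {q} := by
    simp [hH, norm_exp, Real.lt_log_iff_exp_lt hr]
  have hconv : Convex ℝ H := convex_halfSpace_re_lt _
  have hne : H.Nonempty := ⟨((Real.log r - 1 : ℝ) : ℂ), by simp [hH]⟩
  have hopen : IsOpen H := isOpen_lt continuous_re continuous_const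
  obtain ⟨G, hG, hGF⟩ := exists_continuousOn_eqOn_exp_comp (hconv.isSimplyConnected hne) hopen
    (g := fun w ↦ F (q + exp w))
    (hF.comp (by fun_prop) fun w hw ↦ (hmem w).1 hw)
    (by rintro ⟨w, hw, h⟩; exact h0 _ ((hmem w).1 hw) h)
  have hGF' w (hw : w ∈ H) : exp (G w) = F (q + exp w) := hGF hw
  have hshift {w} (n : ℤ) (hw : w ∈ H) : w + n * (2 * Real.pi * I) ∈ H := by
    simpa [hH] using hw
  have hshift1 {w} (hw : w ∈ H) : w + 2 * Real.pi * I ∈ H := by simpa using hshift 1 hw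
  have hexp w (hw : w ∈ H) : exp (G (w + 2 * Real.pi * I)) = exp (G w) := by
    rw [hGF' _ (hshift1 hw), hGF' _ hw, exp_periodic]
  obtain ⟨w₀, hw₀⟩ := hne
  obtain ⟨c, hc⟩ := exp_eq_exp_iff_exists_int.1 (hexp w₀ hw₀)
  have hstep w (hw : w ∈ H) : G (w + 2 * Real.pi * I) = G w + c * (2 * Real.pi * I) := by
    have := hconv.isPreconnected.sub_eq_sub_of_exp_eq
      (hG.comp (by fun_prop) fun w hw ↦ hshift1 hw) hG hexp hw hw₀
    simp only [Function.comp_apply, hc] at this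
    linear_combination this
  have hsteps (n : ℤ) : ∀ w ∈ H,
      G (w + n * (2 * Real.pi * I)) = G w + (c * n : ℤ) * (2 * Real.pi * I) := by
    induction n with
    | zero => simp
    | succ n ih =>
      intro w hw
      have h1 := hstep _ (hshift n hw)
      have h2 := ih w hw
      push_cast at h1 h2 ⊢
      rw [show w + (n + 1 : ℂ) * (2 * Real.pi * I)
        = w + n * (2 * Real.pi * I) + 2 * Real.pi * I by ring, h1, h2]
      ring
    | pred n ih =>
      intro w hw
      have h1 := hstep _ (hshift (-n - 1) hw)
      have h2 := ih w hw
      push_cast at h1 h2 ⊢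
      rw [show w + (-n - 1 : ℂ) * (2 * Real.pi * I) + 2 * Real.pi * I
        = w + -n * (2 * Real.pi * I) by ring, h2] at h1
      linear_combination -h1
  refine ⟨c, fun f n hf ⟨g, hg, hgf, hgn⟩ ↦ ?_⟩
  have hqf θ : q + exp (g θ) = f θ := by rw [hgf]; ring
  have hgH θ : g θ ∈ H := by
    rw [hmem, hqf]
    exact ⟨hf θ, fun h ↦ exp_ne_zero (g θ) ((hgf θ).trans (sub_eq_zero.2 h))⟩
  refine ⟨G ∘ g, hG.comp_continuous hg hgH, fun θ ↦ ?_, ?_⟩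
  · rw [Function.comp_apply, hGF' _ (hgH θ), hqf]
  · rw [Function.comp_apply, hgn, hsteps n _ (hgH 0)]; rfl

/-- A space is not homeomorphic to an open subset of the plane if, arbitrarily close to one of its
points `p`, it contains loops avoiding `p` whose winding numbers under two maps vanishing at most
at `p` are not proportional. -/
lemma isEmpty_homeomorph_of_hasWinding {Y : Type*} [TopologicalSpace Y] {A O : Set Y} {p : Y}
    (hpA : p ∈ A) (hO : O ∈ nhds p) {φ ψ : Y → ℂ} (hφ : ContinuousOn φ O) (hψ : ContinuousOn ψ O)
    (hφ0 : ∀ y ∈ A ∩ O, y ≠ p → φ y ≠ 0) (hψ0 : ∀ y ∈ A ∩ O, y ≠ p → ψ y ≠ 0)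
    (hloop : ∀ U ∈ nhds p, ∃ α β : ℝ → Y, Continuous α ∧ Continuous β ∧
      (∀ θ, α θ ∈ A ∩ U ∧ α θ ≠ p) ∧ (∀ θ, β θ ∈ A ∩ U ∧ β θ ≠ p) ∧
      α (2 * Real.pi) = α 0 ∧ β (2 * Real.pi) = β 0 ∧
      HasWinding (φ ∘ α) 1 ∧ HasWinding (φ ∘ β) 0 ∧ HasWinding (ψ ∘ β) 1)
    {W : Set ℂ} (hW : IsOpen W) : IsEmpty (A ≃ₜ W) := by
  classical
  refine ⟨fun e ↦ ?_⟩
  set q : ℂ := ((e ⟨p, hpA⟩ : W) : ℂ)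
  set E : ℂ → Y := fun w ↦ if h : w ∈ W then e.symm ⟨w, h⟩ else p
  set K : Y → ℂ := fun y ↦ if h : y ∈ A then e ⟨y, h⟩ else q
  have hE (w : W) : E w = e.symm w := by simp [E]
  have hK (y : A) : K y = e y := by simp [K]
  have hEc : ContinuousOn E W := by
    rw [continuousOn_iff_continuous_domRestrict]
    exact (continuous_subtype_val.comp e.symm.continuous).congr fun w ↦ (hE w).symm
  have hKc : ContinuousOn K A := by
    rw [continuousOn_iff_continuous_domRestrict]
    exact (continuous_subtype_val.comp e.continuous).congr fun y ↦ (hK y).symm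
  have hEA {w} (hw : w ∈ W) : E w ∈ A := by rw [hE ⟨w, hw⟩]; exact Subtype.coe_prop _
  have hKW {y} (hy : y ∈ A) : K y ∈ W := by rw [hK ⟨y, hy⟩]; exact Subtype.coe_prop _
  have hEK {y} (hy : y ∈ A) : E (K y) = y := by rw [hK ⟨y, hy⟩, hE, e.symm_apply_apply]
  have hKE {w} (hw : w ∈ W) : K (E w) = w := by rw [hE ⟨w, hw⟩, hK, e.apply_symm_apply]
  have hKp : K p = q := hK ⟨p, hpA⟩
  have hqW : q ∈ W := Subtype.coe_prop _
  have hEq : E q = p := by rw [← hKp, hEK hpA]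
  have hEO : E ⁻¹' O ∈ nhds q :=
    (hEc.continuousAt (hW.mem_nhds hqW)).preimage_mem_nhds (by rwa [hEq])
  obtain ⟨r, hr, hball⟩ := Metric.mem_nhds_iff.1 (Filter.inter_mem (hW.mem_nhds hqW) hEO)
  have key {χ : Y → ℂ} (hχ : ContinuousOn χ O) (hχ0 : ∀ y ∈ A ∩ O, y ≠ p → χ y ≠ 0) :=
    exists_hasWinding_comp (F := χ ∘ E) (q := q) hr
      (hχ.comp (hEc.mono fun w hw ↦ (hball hw.1).1) fun w hw ↦ (hball hw.1).2)
      (fun w hw ↦ hχ0 _ ⟨hEA (hball hw.1).1, (hball hw.1).2⟩ fun h ↦ hw.2 <| by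
        rw [mem_singleton_iff, ← hKE (hball hw.1).1, h, hKp])
  obtain ⟨c, hc⟩ := key hφ hφ0
  obtain ⟨d, hd⟩ := key hψ hψ0
  have hKU : K ⁻¹' ball q r ∈ nhdsWithin p A :=
    hKc p hpA (by rw [hKp]; exact ball_mem_nhds q hr)
  obtain ⟨U, hU, hUA⟩ := mem_nhdsWithin_iff_exists_mem_nhds_inter.1 hKU
  obtain ⟨α, β, hα, hβ, hαm, hβm, hα1, hβ1, hφα, hφβ, hψβ⟩ := hloop U hU
  have wind {γ : ℝ → Y} (hγ : Continuous γ) (hm : ∀ θ, γ θ ∈ A ∩ U ∧ γ θ ≠ p)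
      (hcl : γ (2 * Real.pi) = γ 0) :
      (∀ θ, K (γ θ) ∈ ball q r) ∧ ∃ n, HasWinding (fun θ ↦ K (γ θ) - q) n := by
    refine ⟨fun θ ↦ hUA ⟨(hm θ).1.2, (hm θ).1.1⟩, exists_hasWinding
      ((hKc.comp_continuous hγ fun θ ↦ (hm θ).1.1).sub continuous_const) (fun θ h ↦ (hm θ).2 ?_)
      (by rw [hcl])⟩
    rw [← hEK (hm θ).1.1, sub_eq_zero.1 h, hEq]
  have pull {χ : Y → ℂ} {γ : ℝ → Y} (hm : ∀ θ, γ θ ∈ A ∩ U ∧ γ θ ≠ p) :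
      (fun θ ↦ (χ ∘ E) (K (γ θ))) = χ ∘ γ :=
    funext fun θ ↦ congrArg χ (hEK (hm θ).1.1)
  obtain ⟨hαb, m, hm⟩ := wind hα hαm hα1
  obtain ⟨hβb, k, hk⟩ := wind hβ hβm hβ1
  have h1 := hc _ _ hαb hm
  have h2 := hc _ _ hβb hk
  have h3 := hd _ _ hβb hk
  rw [pull hαm] at h1
  rw [pull hβm] at h2 h3
  have e1 := h1.unique hφα
  have e2 := h2.unique hφβ
  have e3 := h3.unique hψβ
  rcases mul_eq_zero.1 e2 with h | h <;> simp_all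

lemma hasWinding_of_mem_slitPlane {f : ℝ → ℂ} (hf : Continuous f) (k : ℤ)
    (hk : ∀ θ : ℝ, f θ * exp (-(k * θ * I)) ∈ slitPlane) (hper : f (2 * Real.pi) = f 0) :
    HasWinding f k := by
  refine ⟨fun θ ↦ log (f θ * exp (-(k * θ * I))) + k * θ * I, ?_, fun θ ↦ ?_, ?_⟩
  · exact (Continuous.clog (by fun_prop) hk).add (by fun_prop)
  · rw [exp_add, exp_log (slitPlane_ne_zero (hk θ)), mul_assoc, ← exp_add]
    simp
  · have : exp (-(k * (2 * Real.pi : ℝ) * I)) = 1 := by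
      rw [exp_eq_one_iff]; exact ⟨-k, by push_cast; ring⟩
    simp only [hper, this]
    push_cast
    simp only [mul_zero, zero_mul, neg_zero, exp_zero, add_zero]
    ring

/-- The point of the surface `z = m √(1 - t² - y²)` with `tfun x y = t` and `y = y₀ + η`. -/
noncomputable def sheet (y₀ t η m : ℝ) : ℝ × ℝ × ℝ :=
  (t + Real.sin (1 / (y₀ + η + 2)), y₀ + η, m * √(1 - t ^ 2 - (y₀ + η) ^ 2))

lemma tfun_sheet (y₀ t η m : ℝ) : tfun (sheet y₀ t η m).1 (sheet y₀ t η m).2.1 = t := by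
  simp [tfun, sheet]

lemma continuousAt_tfun_s13 {v : ℝ × ℝ × ℝ} (hv : v.2.1 + 2 ≠ 0) :
    ContinuousAt (fun v : ℝ × ℝ × ℝ ↦ tfun v.1 v.2.1) v := by
  unfold tfun
  fun_prop (disch := assumption)

lemma sheet_mem_S3 {y₀ t η m : ℝ} (h : 0 ≤ 1 - t ^ 2 - (y₀ + η) ^ 2) (hm : m = 0 ∨ m = t) :
    sheet y₀ t η m ∈ S3 := by
  rcases hm with rfl | rfl
  · right; simp [sheet]
  · left
    refine ⟨?_, ?_, ?_⟩
    · simp only [sheet]; nlinarith [sq_nonneg m]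
    · simp only [sheet]; nlinarith [sq_nonneg m]
    · rw [tfun_sheet]
      simp only [sheet]
      rw [mul_pow, Real.sq_sqrt h, mul_comm]

/-- The complex number `t + (y - y₀) i`, which vanishes on `S₃` only at the given point. -/
noncomputable def flatMap (y₀ : ℝ) (v : ℝ × ℝ × ℝ) : ℂ :=
  (tfun v.1 v.2.1 : ℝ) + (v.2.1 - y₀ : ℝ) * I

/-- The real part of this map separates the sheet `z = 0` from the sheets `z = ± t √(1 - t² - y²)`
as long as `κ < √(1 - t² - y²)`. -/
noncomputable def foldMap (y₀ κ : ℝ) (v : ℝ × ℝ × ℝ) : ℂ :=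
  (|v.2.2| - κ * |tfun v.1 v.2.1| : ℝ) + (v.2.1 - y₀ : ℝ) * I

lemma eq_of_tfun_eq_zero {y₀ : ℝ} {v : ℝ × ℝ × ℝ} (hv : v ∈ S3) (ht : tfun v.1 v.2.1 = 0)
    (hy : v.2.1 = y₀) : v = (Real.sin (1 / (y₀ + 2)), y₀, (0 : ℝ)) := by
  have hz : v.2.2 = 0 := by
    rcases hv with ⟨-, -, h⟩ | h
    · simpa [ht] using h
    · exact h
  obtain ⟨x, y, z⟩ := v
  simp only [tfun] at *
  subst hy hz
  rw [sub_eq_zero.1 ht]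

lemma flatMap_ne_zero {y₀ : ℝ} {v : ℝ × ℝ × ℝ} (hv : v ∈ S3)
    (hne : v ≠ (Real.sin (1 / (y₀ + 2)), y₀, (0 : ℝ))) : flatMap y₀ v ≠ 0 := by
  intro h
  have hre := congrArg re h
  have him := congrArg im h
  simp [flatMap] at hre him
  exact hne (eq_of_tfun_eq_zero hv hre (by linarith))

lemma foldMap_ne_zero {y₀ κ : ℝ} {v : ℝ × ℝ × ℝ} (hκ : 0 < κ) (hv : v ∈ S3)
    (hκv : κ ^ 2 < 1 - tfun v.1 v.2.1 ^ 2 - v.2.1 ^ 2)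
    (hne : v ≠ (Real.sin (1 / (y₀ + 2)), y₀, (0 : ℝ))) : foldMap y₀ κ v ≠ 0 := by
  intro h
  have hre := congrArg re h
  have him := congrArg im h
  simp [foldMap] at hre him
  refine hne (eq_of_tfun_eq_zero hv ?_ (by linarith))
  have habs : |v.2.2| = κ * |tfun v.1 v.2.1| := by linarith
  have hsq : v.2.2 ^ 2 = κ ^ 2 * tfun v.1 v.2.1 ^ 2 := by
    rw [← sq_abs, habs, mul_pow, sq_abs]
  rcases hv with ⟨-, -, h⟩ | h
  · rw [hsq] at h
    have : (1 - tfun v.1 v.2.1 ^ 2 - v.2.1 ^ 2 - κ ^ 2) * tfun v.1 v.2.1 ^ 2 = 0 := by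
      linear_combination -h
    exact pow_eq_zero_iff two_ne_zero |>.1 ((mul_eq_zero.1 this).resolve_left (by linarith))
  · have hz : v.2.2 = 0 := h
    rw [hz, abs_zero, zero_eq_mul] at habs
    exact abs_eq_zero.1 (habs.resolve_left hκ.ne')

lemma continuousAt_sheet {y₀ : ℝ} {u : ℝ × ℝ × ℝ} (hu : y₀ + u.2.1 + 2 ≠ 0) :
    ContinuousAt (fun u : ℝ × ℝ × ℝ ↦ sheet y₀ u.1 u.2.1 u.2.2) u := by
  unfold sheet
  fun_prop (disch := assumption)

lemma exists_loops {y₀ κ : ℝ} (hκ : 0 < κ) (h₁ : -1 < y₀) {U : Set (ℝ × ℝ × ℝ)}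
    (hU : U ∈ nhds (Real.sin (1 / (y₀ + 2)), y₀, (0 : ℝ)))
    (hUκ : ∀ v ∈ U, κ ^ 2 < 1 - tfun v.1 v.2.1 ^ 2 - v.2.1 ^ 2) :
    ∃ α β : ℝ → ℝ × ℝ × ℝ, Continuous α ∧ Continuous β ∧
      (∀ θ, α θ ∈ S3 ∩ U ∧ α θ ≠ (Real.sin (1 / (y₀ + 2)), y₀, (0 : ℝ))) ∧
      (∀ θ, β θ ∈ S3 ∩ U ∧ β θ ≠ (Real.sin (1 / (y₀ + 2)), y₀, (0 : ℝ))) ∧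
      α (2 * Real.pi) = α 0 ∧ β (2 * Real.pi) = β 0 ∧
      HasWinding (flatMap y₀ ∘ α) 1 ∧ HasWinding (flatMap y₀ ∘ β) 0 ∧
      HasWinding (foldMap y₀ κ ∘ β) 1 := by
  have hpre : (fun u : ℝ × ℝ × ℝ ↦ sheet y₀ u.1 u.2.1 u.2.2) ⁻¹' U ∈
      nhds ((0 : ℝ), (0 : ℝ), (0 : ℝ)) := by
    refine (continuousAt_sheet (by simp; linarith)).preimage_mem_nhds ?_
    simpa [sheet] using hU
  obtain ⟨δ, hδ, hball⟩ := Metric.mem_nhds_iff.1 hpre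
  obtain ⟨ε, hε, hεδ⟩ := exists_between hδ
  have hcos (θ : ℝ) : |ε * Real.cos θ| < δ := by
    rw [abs_mul, abs_of_pos hε]
    nlinarith [Real.abs_cos_le_one θ]
  have hsin (θ : ℝ) : |ε * Real.sin θ| < δ := by
    rw [abs_mul, abs_of_pos hε]
    nlinarith [Real.abs_sin_le_one θ]
  have hmem {t η m : ℝ} (ht : |t| < δ) (hη : |η| < δ) (hm : |m| < δ) : sheet y₀ t η m ∈ U :=
    hball (a := (t, η, m)) (by simp [Prod.dist_eq, ht, hη, hm])
  have hbd {t η m : ℝ} (h : sheet y₀ t η m ∈ U) : κ ^ 2 < 1 - t ^ 2 - (y₀ + η) ^ 2 := by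
    have := hUκ _ h
    rwa [tfun_sheet] at this
  have hcont {t η m : ℝ → ℝ} (ht : Continuous t) (hη : Continuous η) (hm : Continuous m)
      (h : ∀ θ, sheet y₀ (t θ) (η θ) (m θ) ∈ U) :
      Continuous fun θ ↦ sheet y₀ (t θ) (η θ) (m θ) :=
    continuous_iff_continuousAt.2 fun θ ↦
      (continuousAt_sheet (u := (t θ, η θ, m θ))
        (by have := hbd (h θ); simp only; nlinarith [sq_nonneg (t θ), sq_nonneg κ])).comp
        (f := fun θ ↦ (t θ, η θ, m θ)) (by fun_prop)
  have hne {θ t m : ℝ} (ht : t = 0 → Real.cos θ = 0) : sheet y₀ t (ε * Real.sin θ) m ≠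
      (Real.sin (1 / (y₀ + 2)), y₀, (0 : ℝ)) := by
    intro h
    have h0 : t = 0 := by
      rw [← tfun_sheet y₀ t (ε * Real.sin θ) m, h]; simp [tfun]
    have h1 : ε * Real.sin θ = 0 := by
      have := congrArg (fun v ↦ v.2.1) h
      simpa [sheet] using this
    have h2 := (mul_eq_zero.1 h1).resolve_left hε.ne'
    simpa [ht h0, h2] using Real.sin_sq_add_cos_sq θ
  have hαU θ : sheet y₀ (ε * Real.cos θ) (ε * Real.sin θ) 0 ∈ U :=
    hmem (hcos θ) (hsin θ) (by simpa using hδ)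
  have hβU θ : sheet y₀ |ε * Real.cos θ| (ε * Real.sin θ) (max 0 (ε * Real.cos θ)) ∈ U := by
    refine hmem (by simpa using hcos θ) (hsin θ) ?_
    rw [abs_of_nonneg (le_max_left _ _)]
    exact max_lt hδ ((le_abs_self _).trans_lt (hcos θ))
  have hα := hcont (by fun_prop) (by fun_prop) (by fun_prop) hαU
  have hβ := hcont (by fun_prop) (by fun_prop) (by fun_prop) hβU
  have hfin {χ : ℝ × ℝ × ℝ → ℂ} {γ : ℝ → ℝ × ℝ × ℝ} (hγ : Continuous γ) (hγU : ∀ θ, γ θ ∈ U)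
      (hχ : ∀ v ∈ U, ContinuousAt χ v) : Continuous (χ ∘ γ) :=
    continuous_iff_continuousAt.2 fun θ ↦ (hχ _ (hγU θ)).comp hγ.continuousAt
  have htc v (hv : v ∈ U) : ContinuousAt (fun v : ℝ × ℝ × ℝ ↦ tfun v.1 v.2.1) v :=
    continuousAt_tfun_s13 (by have := hUκ v hv; nlinarith [sq_nonneg (tfun v.1 v.2.1), sq_nonneg κ])
  have hflat v (hv : v ∈ U) : ContinuousAt (flatMap y₀) v := by
    have := htc v hv
    unfold flatMap
    fun_prop
  have hfold v (hv : v ∈ U) : ContinuousAt (foldMap y₀ κ) v := by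
    have := htc v hv
    unfold foldMap
    fun_prop
  have hα1 : sheet y₀ (ε * Real.cos (2 * Real.pi)) (ε * Real.sin (2 * Real.pi)) 0 =
    sheet y₀ (ε * Real.cos 0) (ε * Real.sin 0) 0 := by simp
  have hβ1 : sheet y₀ |ε * Real.cos (2 * Real.pi)| (ε * Real.sin (2 * Real.pi))
      (max 0 (ε * Real.cos (2 * Real.pi))) =
    sheet y₀ |ε * Real.cos 0| (ε * Real.sin 0) (max 0 (ε * Real.cos 0)) := by simp
  have hrot (a b θ : ℝ) : ((a + b * I : ℂ) * exp (-((1 : ℤ) * θ * I))).re =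
      a * Real.cos θ + b * Real.sin θ := by
    rw [show (-((1 : ℤ) * θ * I) : ℂ) = ((-θ : ℝ) : ℂ) * I by push_cast; ring, exp_mul_I,
      ← ofReal_cos, ← ofReal_sin]
    simp [-ofReal_cos, -ofReal_sin]
  refine ⟨_, _, hα, hβ,
    fun θ ↦ ⟨⟨sheet_mem_S3 ((sq_nonneg κ).trans (hbd (hαU θ)).le) (.inl rfl), hαU θ⟩,
      hne fun h ↦ (mul_eq_zero.1 h).resolve_left hε.ne'⟩,
    fun θ ↦ ⟨⟨sheet_mem_S3 ((sq_nonneg κ).trans (hbd (hβU θ)).le) ?_, hβU θ⟩,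
      hne fun h ↦ (mul_eq_zero.1 (abs_eq_zero.1 h)).resolve_left hε.ne'⟩, hα1, hβ1,
    hasWinding_of_mem_slitPlane (hfin hα hαU hflat) 1 (fun θ ↦ .inl ?_)
      (congrArg (flatMap y₀) hα1),
    hasWinding_of_mem_slitPlane (hfin hβ hβU hflat) 0 (fun θ ↦ ?_)
      (congrArg (flatMap y₀) hβ1),
    hasWinding_of_mem_slitPlane (hfin hβ hβU hfold) 1 (fun θ ↦ .inl ?_)
      (congrArg (foldMap y₀ κ) hβ1)⟩
  · rcases le_total 0 (ε * Real.cos θ) with h | h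
    · right; rw [max_eq_right h, abs_of_nonneg h]
    · left; exact max_eq_left h
  · rw [Function.comp_apply, flatMap, hrot, tfun_sheet]
    simp only [sheet]
    nlinarith [Real.sin_sq_add_cos_sq θ]
  · rw [Function.comp_apply, flatMap, tfun_sheet]
    simp only [sheet, mem_slitPlane_iff]
    by_cases h : Real.cos θ = 0
    · right
      have : Real.sin θ ≠ 0 := fun h' ↦ by simpa [h, h'] using Real.sin_sq_add_cos_sq θ
      simp [-ofReal_cos, -ofReal_sin, -ofReal_mul, this, hε.ne']
    · left
      simp [-ofReal_cos, -ofReal_sin, -ofReal_mul, h, hε.ne']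
  · rw [Function.comp_apply, foldMap, hrot, tfun_sheet]
    have hs := Real.lt_sqrt_of_sq_lt (hbd (hβU θ))
    simp only [sheet] at hs ⊢
    set s := √(1 - |ε * Real.cos θ| ^ 2 - (y₀ + ε * Real.sin θ) ^ 2)
    rw [abs_abs, add_sub_cancel_left]
    have hpos : ∀ l > 0, 0 < l * (ε * Real.cos θ ^ 2) + ε * Real.sin θ ^ 2 := by
      intro l hl
      rcases eq_or_ne (Real.cos θ) 0 with h | h
      · have := Real.sin_sq_add_cos_sq θ
        rw [h] at this ⊢
        nlinarith
      · positivity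
    rcases le_total 0 (ε * Real.cos θ) with h | h
    · rw [max_eq_right h, abs_of_nonneg (mul_nonneg h (hκ.trans hs).le), abs_of_nonneg h]
      linarith [hpos (s - κ) (sub_pos.2 hs)]
    · rw [max_eq_left h, abs_of_nonpos h, zero_mul, abs_zero]
      linarith [hpos κ hκ]

theorem stmt_13 (y₀ : ℝ) (h₁ : -1 < y₀) (h₂ : y₀ < 1) :
    ¬ ∃ (V : Set (ℝ × ℝ × ℝ)) (W : Set (ℝ × ℝ)),
      IsOpen V ∧ (Real.sin (1 / (y₀ + 2)), y₀, (0 : ℝ)) ∈ V ∧ IsOpen W ∧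
      Nonempty (↥(S3 ∩ V) ≃ₜ ↥W) := by
  rintro ⟨V, W, hV, hpV, hW, ⟨e⟩⟩
  obtain ⟨κ, hκ, hκy⟩ : ∃ κ : ℝ, 0 < κ ∧ κ ^ 2 < 1 - y₀ ^ 2 :=
    have hpos : 0 < (1 - y₀ ^ 2) / 2 := by nlinarith
    ⟨√((1 - y₀ ^ 2) / 2), Real.sqrt_pos.2 hpos, by rw [Real.sq_sqrt hpos.le]; linarith⟩
  set p : ℝ × ℝ × ℝ := (Real.sin (1 / (y₀ + 2)), y₀, (0 : ℝ))
  set O : Set (ℝ × ℝ × ℝ) := {v | κ ^ 2 < 1 - tfun v.1 v.2.1 ^ 2 - v.2.1 ^ 2}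
  have htO v (hv : v ∈ O) : ContinuousAt (fun v : ℝ × ℝ × ℝ ↦ tfun v.1 v.2.1) v := by
    refine continuousAt_tfun_s13 ?_
    have : κ ^ 2 < 1 - tfun v.1 v.2.1 ^ 2 - v.2.1 ^ 2 := hv
    nlinarith [sq_nonneg (tfun v.1 v.2.1), sq_nonneg κ]
  have hpO : p ∈ O := by simpa [O, p, tfun] using hκy
  have hO : O ∈ nhds p := by
    have := htO p hpO
    exact ContinuousAt.preimage_mem_nhds
      (f := fun v : ℝ × ℝ × ℝ ↦ 1 - tfun v.1 v.2.1 ^ 2 - v.2.1 ^ 2) (by fun_prop)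
      (Ioi_mem_nhds hpO)
  let E : ℂ ≃ₜ ℝ × ℝ := equivRealProdCLM.toHomeomorph
  refine (isEmpty_homeomorph_of_hasWinding (A := S3 ∩ V) (O := O) (p := p)
    (φ := flatMap y₀) (ψ := foldMap y₀ κ) ⟨.inr rfl, hpV⟩ hO (fun v hv ↦ ?_) (fun v hv ↦ ?_)
    (fun v hv ↦ flatMap_ne_zero hv.1.1) (fun v hv ↦ foldMap_ne_zero hκ hv.1.1 hv.2)
    (fun U hU ↦ ?_) (hW.preimage E.continuous)).false (e.trans (E.sets rfl).symm)
  · have := htO v hv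
    refine ContinuousAt.continuousWithinAt ?_
    unfold flatMap
    fun_prop
  · have := htO v hv
    refine ContinuousAt.continuousWithinAt ?_
    unfold foldMap
    fun_prop
  · obtain ⟨α, β, hα, hβ, hαm, hβm, h⟩ := exists_loops hκ h₁
      (Filter.inter_mem (Filter.inter_mem hU (hV.mem_nhds hpV)) hO) fun v hv ↦ hv.2
    exact ⟨α, β, hα, hβ,
      fun θ ↦ ⟨⟨⟨(hαm θ).1.1, (hαm θ).1.2.1.2⟩, (hαm θ).1.2.1.1⟩, (hαm θ).2⟩,
      fun θ ↦ ⟨⟨⟨(hβm θ).1.1, (hβm θ).1.2.1.2⟩, (hβm θ).1.2.1.1⟩, (hβm θ).2⟩, h⟩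
end

section
/- Let Ω ⊆ ℝ³ be a connected open set containing S₄, and let r : ℝ³ → ℝ be real-analytic on Ω (AnalyticOn ℝ) with r(p) = 0 for every p ∈ S₄. Then r is identically zero on Ω. -/
/-- The spherical-coordinates map `Φ`. -/
noncomputable def Phi (p : ℝ × ℝ × ℝ) : ℝ × ℝ × ℝ :=
  ((p.2.2 + 1) * Real.sin (1 + p.2.1 / 2) * Real.cos p.1,
   (p.2.2 + 1) * Real.sin (1 + p.2.1 / 2) * Real.sin p.1,
   (p.2.2 + 1) * Real.cos (1 + p.2.1 / 2))

/-- The domain `D`. -/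
def Dset : Set (ℝ × ℝ × ℝ) :=
  {p | -Real.pi < p.1 ∧ p.1 < Real.pi ∧ -2 < p.2.1 ∧ p.2.1 < 2 * Real.pi - 2 ∧
    -1 < p.2.2}

/-- The compact variety `S₄`. -/
noncomputable def S4 : Set (ℝ × ℝ × ℝ) := closure (Phi '' (S3 ∩ Dset))

open Set Filter Topology

lemma exists_zero_of_iterated_rolle (g : ℕ → ℝ → ℝ) {b : ℝ} (hb : 0 < b) (hgb : g 0 b = 0)
    (k : ℕ) (hd : ∀ j < k, ∀ z ∈ Icc 0 b, HasDerivAt (g j) (g (j + 1) z) z)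
    (h0 : ∀ j < k, g j 0 = 0) : ∃ ξ ∈ Icc 0 b, 0 < ξ ∧ g k ξ = 0 := by
  induction k with
  | zero => exact ⟨b, ⟨hb.le, le_rfl⟩, hb, hgb⟩
  | succ k ih =>
    obtain ⟨ξ, hξ, hpos, hz⟩ :=
      ih (fun j hj => hd j (by omega)) (fun j hj => h0 j (by omega))
    have hd' : ∀ z ∈ Icc 0 ξ, HasDerivAt (g k) (g (k + 1) z) z := fun z hz =>
      hd k (by omega) z ⟨hz.1, hz.2.trans hξ.2⟩
    obtain ⟨c, hc, hc0⟩ := exists_hasDerivAt_eq_zero hpos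
      (fun z hz => (hd' z hz).continuousAt.continuousWithinAt)
      (by rw [h0 k (by omega), hz]) (fun z hz => hd' z (Ioo_subset_Icc_self hz))
    exact ⟨c, ⟨hc.1.le, hc.2.le.trans hξ.2⟩, hc.1, hc0⟩

lemma eventually_eq_zero_of_iterated_deriv (g : ℕ → ℝ → ℝ) {a : ℝ} (hg : AnalyticAt ℝ (g 0) a)
    (hd : ∀ j, ∀ᶠ z in 𝓝 a, HasDerivAt (g j) (g (j + 1) z) z)
    (h0 : ∀ j, g j a = 0) : ∀ᶠ z in 𝓝 a, g 0 z = 0 := by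
  have key : ∀ k, iteratedDeriv k (g 0) =ᶠ[𝓝 a] g k := by
    intro k
    induction k with
    | zero => simp
    | succ k ih =>
      rw [iteratedDeriv_succ]
      exact ih.deriv.trans ((hd k).mono fun z hz => hz.deriv)
  rw [← analyticOrderAt_eq_top, ENat.eq_top_iff_forall_ge]
  intro n
  rw [natCast_le_analyticOrderAt_iff_iteratedDeriv_eq_zero hg]
  intro i _
  rw [(key i).eq_of_nhds, h0]

/-- The `k`-th partial derivative in the third coordinate. -/
noncomputable def zDeriv (f : ℝ × ℝ × ℝ → ℝ) (k : ℕ) : ℝ × ℝ × ℝ → ℝ :=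
  (fun g p => fderiv ℝ g p (0, 0, 1))^[k] f

lemma zDeriv_succ (f : ℝ × ℝ × ℝ → ℝ) (k : ℕ) (p : ℝ × ℝ × ℝ) :
    zDeriv f (k + 1) p = fderiv ℝ (zDeriv f k) p (0, 0, 1) := by
  simp only [zDeriv, Function.iterate_succ_apply']

lemma analyticOnNhd_zDeriv {f : ℝ × ℝ × ℝ → ℝ} {W : Set (ℝ × ℝ × ℝ)}
    (hf : AnalyticOnNhd ℝ f W) (k : ℕ) : AnalyticOnNhd ℝ (zDeriv f k) W := by
  induction k with
  | zero => exact hf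
  | succ k ih =>
    intro p hp
    have hd : AnalyticAt ℝ (fderiv ℝ (zDeriv f k)) p := ih.fderiv p hp
    rw [show zDeriv f (k + 1) = fun p => fderiv ℝ (zDeriv f k) p (0, 0, 1) from
      funext fun p => zDeriv_succ f k p]
    exact (ContinuousLinearMap.apply ℝ ℝ ((0, 0, 1) : ℝ × ℝ × ℝ)).analyticAt _ |>.comp hd

lemma hasDerivAt_zDeriv {f : ℝ × ℝ × ℝ → ℝ} {W : Set (ℝ × ℝ × ℝ)}
    (hf : AnalyticOnNhd ℝ f W) (k : ℕ) {x y z : ℝ} (h : (x, y, z) ∈ W) :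
    HasDerivAt (fun s => zDeriv f k (x, y, s)) (zDeriv f (k + 1) (x, y, z)) z := by
  rw [zDeriv_succ]
  have h1 : HasDerivAt (fun s : ℝ => (x, y, s)) (0, 0, 1) z :=
    (hasDerivAt_const z x).prodMk ((hasDerivAt_const z y).prodMk (hasDerivAt_id z))
  exact (analyticOnNhd_zDeriv hf k _ h).differentiableAt.hasFDerivAt.comp_hasDerivAt z h1

lemma analyticOnNhd_Phi : AnalyticOnNhd ℝ Phi univ := by
  intro p _
  have h1 : AnalyticAt ℝ (fun p : ℝ × ℝ × ℝ => p.1) p := analyticAt_fst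
  have h2 : AnalyticAt ℝ (fun p : ℝ × ℝ × ℝ => p.2.1) p := analyticAt_fst.comp analyticAt_snd
  have h3 : AnalyticAt ℝ (fun p : ℝ × ℝ × ℝ => p.2.2) p := analyticAt_snd.comp analyticAt_snd
  have h4 : AnalyticAt ℝ (fun p : ℝ × ℝ × ℝ => 1 + p.2.1 / 2) p :=
    analyticAt_const.add (h2.div analyticAt_const two_ne_zero)
  have h5 := h3.add (analyticAt_const (v := (1 : ℝ)))
  have hs : ∀ {g : ℝ × ℝ × ℝ → ℝ}, AnalyticAt ℝ g p → AnalyticAt ℝ (fun q => Real.sin (g q)) p :=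
    fun hg => AnalyticAt.comp (g := Real.sin) (by fun_prop) hg
  have hc : ∀ {g : ℝ × ℝ × ℝ → ℝ}, AnalyticAt ℝ g p → AnalyticAt ℝ (fun q => Real.cos (g q)) p :=
    fun hg => AnalyticAt.comp (g := Real.cos) (by fun_prop) hg
  exact ((h5.mul (hs h4)).mul (hc h1)).prod
    (((h5.mul (hs h4)).mul (hs h1)).prod (h5.mul (hc h4)))

lemma continuous_Phi : Continuous Phi := by
  unfold Phi
  fun_prop

lemma Phi_mem_S4 {x y : ℝ} (hx : |x| < 1) (hy : -2 ≤ y) (hy2 : y < 2) :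
    Phi (x, y, 0) ∈ S4 := by
  have hpi := Real.pi_gt_three
  have hx' := abs_lt.1 hx
  have hc : Continuous fun y : ℝ => Phi (x, y, 0) := continuous_Phi.comp (by fun_prop)
  refine mem_closure_of_tendsto (hc.continuousAt.tendsto.mono_left
    (nhdsWithin_le_nhds (s := Ioi y))) ?_
  filter_upwards [self_mem_nhdsWithin, nhdsWithin_le_nhds (eventually_lt_nhds hy2)] with s hs hs2
  have hs : y < s := hs
  exact ⟨_, ⟨Or.inr rfl, by linarith, by linarith, by linarith, by linarith, by norm_num⟩, rfl⟩

lemma Phi_surface_mem_S4 {t y : ℝ} (hy : |y| < 1) (ht : 0 < t) (hty : t ^ 2 + y ^ 2 < 1) :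
    Phi (t + Real.sin (1 / (y + 2)), y, t * √(1 - t ^ 2 - y ^ 2)) ∈ S4 := by
  have hpi := Real.pi_gt_three
  have hy' := abs_lt.1 hy
  have ht1 : t < 1 := by nlinarith [sq_nonneg y]
  have hs := Real.neg_one_le_sin (1 / (y + 2))
  have hs' := Real.sin_le_one (1 / (y + 2))
  have hz : 0 ≤ t * √(1 - t ^ 2 - y ^ 2) := by positivity
  refine subset_closure ⟨_, ⟨Or.inl ⟨?_, ?_, ?_⟩, ?_, ?_, ?_, ?_, ?_⟩, rfl⟩ <;> dsimp only
  · linarith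
  · linarith
  · rw [mul_pow, Real.sq_sqrt (by linarith), tfun]
    ring
  all_goals linarith

lemma abs_sin_inv_lt_one {y : ℝ} (hy : |y| < 1) : |Real.sin (1 / (y + 2))| < 1 := by
  have hy' := abs_lt.1 hy
  have h0 : 0 < 1 / (y + 2) := one_div_pos.2 (by linarith)
  have h1 : 1 / (y + 2) < 1 := by rw [div_lt_one] <;> linarith
  rw [abs_of_pos (Real.sin_pos_of_pos_of_lt_pi h0 (by linarith [Real.pi_gt_three]))]
  exact (Real.sin_lt h0).trans h1

/-- If the transversal derivatives of order less than `k` vanish on the sphere, then the `k`-th one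
vanishes on the singular curve of the surface: Rolle's theorem produces zeros of it between the
sphere and the surface, and these accumulate on the curve. -/
lemma zDeriv_eq_zero_on_curve {f : ℝ × ℝ × ℝ → ℝ} {W : Set (ℝ × ℝ × ℝ)} (hW : IsOpen W)
    (hS : Phi ⁻¹' S4 ⊆ W) (hf : AnalyticOnNhd ℝ f W) (hv : ∀ p, Phi p ∈ S4 → f p = 0) (k : ℕ)
    (ih : ∀ j < k, ∀ x y : ℝ, |x| < 1 → -2 < y → y < 2 → zDeriv f j (x, y, 0) = 0)
    {y : ℝ} (hy : |y| < 1) : zDeriv f k (Real.sin (1 / (y + 2)), y, 0) = 0 := by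
  by_contra hne
  have hy' := abs_lt.1 hy
  have hx0 := abs_sin_inv_lt_one hy
  set x₀ := Real.sin (1 / (y + 2)) with hx₀
  have hx0' := abs_lt.1 hx0
  have hmem : (x₀, y, (0 : ℝ)) ∈ W := hS (Phi_mem_S4 hx0 (by linarith) (by linarith))
  have hnhds : ∀ᶠ q in 𝓝 (x₀, y, (0 : ℝ)), q ∈ W ∧ zDeriv f k q ≠ 0 :=
    Filter.Eventually.and (hW.mem_nhds hmem)
      ((analyticOnNhd_zDeriv hf k _ hmem).continuousAt.eventually_ne hne)
  obtain ⟨ε, hε, hball⟩ := Metric.eventually_nhds_iff.1 hnhds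
  have hev : ∀ᶠ t in 𝓝[>] (0 : ℝ), 0 < t ∧ t < ε ∧ t < 1 - x₀ ∧ t ^ 2 + y ^ 2 < 1 := by
    have hc : ContinuousAt (fun t : ℝ => t ^ 2 + y ^ 2) 0 := by fun_prop
    have hlt : (0 : ℝ) ^ 2 + y ^ 2 < 1 := by nlinarith
    filter_upwards [self_mem_nhdsWithin, nhdsWithin_le_nhds (eventually_lt_nhds hε),
      nhdsWithin_le_nhds (eventually_lt_nhds (show (0 : ℝ) < 1 - x₀ by linarith)),
      nhdsWithin_le_nhds (hc.eventually (eventually_lt_nhds hlt))] with t h1 h2 h3 h4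
    exact ⟨h1, h2, h3, h4⟩
  obtain ⟨t, ht0, htε, htx, hty⟩ := hev.exists
  set b := t * √(1 - t ^ 2 - y ^ 2) with hb
  have hb0 : 0 < b := mul_pos ht0 (Real.sqrt_pos.2 (by linarith))
  have hbt : b ≤ t := by
    refine mul_le_of_le_one_right ht0.le (Real.sqrt_le_one.2 ?_)
    nlinarith [sq_nonneg t, sq_nonneg y]
  have hin : ∀ z ∈ Icc 0 b, (t + x₀, y, z) ∈ W ∧ zDeriv f k (t + x₀, y, z) ≠ 0 := by
    intro z hz
    apply hball
    simp only [Prod.dist_eq, Real.dist_eq, max_lt_iff, add_sub_cancel_right, sub_self, abs_zero,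
      sub_zero, abs_of_pos ht0, abs_of_nonneg hz.1]
    exact ⟨htε, hε, by linarith [hz.2]⟩
  obtain ⟨ξ, hξ, -, hξ0⟩ := exists_zero_of_iterated_rolle
    (fun j s => zDeriv f j (t + x₀, y, s)) hb0 (hv _ (Phi_surface_mem_S4 hy ht0 hty)) k
    (fun j _ z hz => hasDerivAt_zDeriv hf j (hin z hz).1)
    (fun j hj => ih j hj _ _ (abs_lt.2 ⟨by linarith, by linarith⟩) (by linarith) (by linarith))
  exact (hin ξ hξ).2 hξ0

/-- An analytic function vanishing on an arc of the oscillating curve `x = sin (1 / (y + 2))`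
vanishes on the plane region it accumulates on, as it meets every line `x = const` infinitely
often near `y = -2`. -/
lemma eq_zero_of_eq_zero_on_curve {h : ℝ × ℝ → ℝ} {U : Set (ℝ × ℝ)} (hh : AnalyticOnNhd ℝ h U)
    (hU : ∀ x y : ℝ, |x| ≤ 1 → -2 < y → y < 2 → (x, y) ∈ U)
    (hU' : ∀ x y : ℝ, |x| < 1 → -2 ≤ y → y < 2 → (x, y) ∈ U)
    (hc : ∀ y : ℝ, |y| < 1 → h (Real.sin (1 / (y + 2)), y) = 0)
    {x y : ℝ} (hx : |x| < 1) (hy : -2 < y) (hy2 : y < 2) : h (x, y) = 0 := by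
  have hcurve : ∀ s ∈ Ioo (-2 : ℝ) 2, h (Real.sin (1 / (s + 2)), s) = 0 := by
    have han : AnalyticOnNhd ℝ (fun s : ℝ => h (Real.sin (1 / (s + 2)), s)) (Ioo (-2) 2) := by
      intro s hs
      have hne : s + 2 ≠ 0 := by linarith [hs.1]
      have hin : AnalyticAt ℝ (fun s : ℝ => (Real.sin (1 / (s + 2)), s)) s := by
        fun_prop (disch := assumption)
      exact AnalyticAt.comp (g := h) (hh _ (hU _ _ (Real.abs_sin_le_one _) hs.1 hs.2)) hin
    refine han.eqOn_zero_of_preconnected_of_eventuallyEq_zero isPreconnected_Ioo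
      (z₀ := 0) (by norm_num) ?_
    filter_upwards [Ioo_mem_nhds (show (-1 : ℝ) < 0 by norm_num) one_pos] with s hs
    exact hc s (abs_lt.2 hs)
  have han : AnalyticOnNhd ℝ (fun s : ℝ => h (x, s)) (Ico (-2) 2) := fun s hs =>
    AnalyticAt.comp (g := h) (f := fun s : ℝ => (x, s)) (hh _ (hU' x s hx hs.1 hs.2))
      (by fun_prop)
  refine han.eqOn_zero_of_preconnected_of_frequently_eq_zero isPreconnected_Ico
    (z₀ := -2) (by norm_num) ?_ ⟨hy.le, hy2⟩
  have hlim : Tendsto (fun n : ℕ => Real.arcsin x + n * (2 * Real.pi)) atTop atTop :=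
    tendsto_atTop_add_const_left _ _
      (tendsto_natCast_atTop_atTop.atTop_mul_const (by positivity))
  have hseq : Tendsto (fun n : ℕ => (Real.arcsin x + n * (2 * Real.pi))⁻¹ - 2) atTop
      (𝓝[>] (-2)) := by
    refine tendsto_nhdsWithin_iff.2 ⟨?_, ?_⟩
    · simpa using hlim.inv_tendsto_atTop.sub_const 2
    · filter_upwards [hlim.eventually_gt_atTop 0] with n hn
      have := inv_pos.2 hn
      simp only [mem_Ioi]
      linarith
  have hseq' := hseq.mono_right (nhdsWithin_mono _ (fun s (hs : -2 < s) => hs.ne'))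
  refine hseq'.frequently (Eventually.frequently ?_)
  filter_upwards [hseq (Ioo_mem_nhdsGT (show (-2 : ℝ) < 2 by norm_num))] with n hn
  have hz := hcurve _ hn
  have hsin : Real.sin (1 / ((Real.arcsin x + n * (2 * Real.pi))⁻¹ - 2 + 2)) = x := by
    rw [sub_add_cancel, one_div, inv_inv, Real.sin_add_nat_mul_two_pi,
      Real.sin_arcsin (abs_lt.1 hx).1.le (abs_lt.1 hx).2.le]
  rwa [hsin] at hz

lemma Phi_mem_S4_of_abs_le_one {x y : ℝ} (hx : |x| ≤ 1) (hy : -2 < y) (hy2 : y < 2) :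
    Phi (x, y, 0) ∈ S4 := by
  have hpi := Real.pi_gt_three
  have hx' := abs_le.1 hx
  exact subset_closure
    ⟨_, ⟨Or.inr rfl, by linarith, by linarith, hy, by linarith, by norm_num⟩, rfl⟩

lemma zDeriv_eq_zero_on_sphere {f : ℝ × ℝ × ℝ → ℝ} {W : Set (ℝ × ℝ × ℝ)} (hW : IsOpen W)
    (hS : Phi ⁻¹' S4 ⊆ W) (hf : AnalyticOnNhd ℝ f W) (hv : ∀ p, Phi p ∈ S4 → f p = 0) (k : ℕ) :
    ∀ x y : ℝ, |x| < 1 → -2 < y → y < 2 → zDeriv f k (x, y, 0) = 0 := by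
  induction k using Nat.strong_induction_on with
  | _ k ih =>
    intro x y hx hy hy2
    refine eq_zero_of_eq_zero_on_curve (h := fun q => zDeriv f k (q.1, q.2, 0))
      (U := {q | (q.1, q.2, (0 : ℝ)) ∈ W}) (fun q hq => ?_)
      (fun x y hx hy hy2 => hS (Phi_mem_S4_of_abs_le_one hx hy hy2))
      (fun x y hx hy hy2 => hS (Phi_mem_S4 hx hy hy2))
      (fun y hy => zDeriv_eq_zero_on_curve hW hS hf hv k ih hy) hx hy hy2
    have hin : AnalyticAt ℝ (fun q : ℝ × ℝ => (q.1, q.2, (0 : ℝ))) q :=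
      analyticAt_fst.prod (analyticAt_snd.prod analyticAt_const)
    exact AnalyticAt.comp (g := zDeriv f k) (analyticOnNhd_zDeriv hf k _ hq) hin

lemma eventually_eq_zero_of_zDeriv_eq_zero {f : ℝ × ℝ × ℝ → ℝ} {W : Set (ℝ × ℝ × ℝ)}
    (hW : IsOpen W) (hf : AnalyticOnNhd ℝ f W) {x₀ y₀ : ℝ} (h0 : (x₀, y₀, 0) ∈ W)
    (hz : ∀ᶠ q : ℝ × ℝ in 𝓝 (x₀, y₀), ∀ k, zDeriv f k (q.1, q.2, 0) = 0) :
    ∀ᶠ p in 𝓝 (x₀, y₀, (0 : ℝ)), f p = 0 := by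
  obtain ⟨ε, hε, hball⟩ := Metric.eventually_nhds_iff.1 (hW.mem_nhds h0)
  obtain ⟨δ, hδ, hball'⟩ := Metric.eventually_nhds_iff.1 hz
  refine Metric.eventually_nhds_iff.2 ⟨min ε δ, lt_min hε hδ, ?_⟩
  rintro ⟨x, y, z⟩ hp
  rw [Prod.dist_eq, Prod.dist_eq, max_lt_iff, max_lt_iff, lt_min_iff, lt_min_iff, lt_min_iff] at hp
  obtain ⟨⟨hx1, hx2⟩, ⟨hy1, hy2⟩, hz1, -⟩ := hp
  have hin : ∀ s ∈ Metric.ball (0 : ℝ) ε, (x, y, s) ∈ W := fun s hs => hball (by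
    simp only [Prod.dist_eq, max_lt_iff]
    exact ⟨hx1, hy1, hs⟩)
  have han : AnalyticOnNhd ℝ (fun s => f (x, y, s)) (Metric.ball 0 ε) := fun s hs =>
    AnalyticAt.comp (g := f) (f := fun s : ℝ => (x, y, s)) (hf _ (hin s hs)) (by fun_prop)
  refine han.eqOn_zero_of_preconnected_of_eventuallyEq_zero
    (convex_ball 0 ε).isPreconnected (Metric.mem_ball_self hε) ?_ hz1
  refine eventually_eq_zero_of_iterated_deriv (fun k s => zDeriv f k (x, y, s))
    (han 0 (Metric.mem_ball_self hε)) (fun j => ?_) (hball' (y := (x, y)) (max_lt hx2 hy2))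
  filter_upwards [Metric.ball_mem_nhds (0 : ℝ) hε] with s hs
  exact hasDerivAt_zDeriv hf j (hin s hs)

/-- A local inverse of `Phi` near `(1, 0, 0)`. -/
lemma exists_local_inverse_Phi : ∃ g : ℝ × ℝ × ℝ → ℝ × ℝ × ℝ, ContinuousAt g (1, 0, 0) ∧
    g (1, 0, 0) = (0, Real.pi - 2, 0) ∧ ∀ q, Phi (g q) = q := by
  let u : ℝ × ℝ × ℝ → ℂ := fun q => ⟨q.1, q.2.1⟩
  let v : ℝ × ℝ × ℝ → ℂ := fun q => ⟨q.2.2, ‖u q‖⟩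
  have hmk : ∀ a b : ℝ × ℝ × ℝ → ℝ, Continuous a → Continuous b →
      Continuous (fun q => (⟨a q, b q⟩ : ℂ)) := fun a b ha hb =>
    Complex.equivRealProdCLM.symm.continuous.comp (ha.prodMk hb)
  have hu : Continuous u := hmk _ _ (by fun_prop) (by fun_prop)
  have hv : Continuous v := hmk _ _ (by fun_prop) hu.norm
  have hu1 : u (1, 0, 0) = 1 := by simp [u, Complex.ext_iff]
  have hv1 : v (1, 0, 0) = Complex.I := by
    simp only [v, hu1]
    simp [Complex.ext_iff]
  refine ⟨fun q => ((u q).arg, 2 * ((v q).arg - 1), ‖v q‖ - 1), ?_, ?_, ?_⟩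
  · have h1 : ContinuousAt (fun q => (u q).arg) (1, 0, 0) :=
      ContinuousAt.comp (Complex.continuousAt_arg (by simp [hu1])) hu.continuousAt
    have h2 : ContinuousAt (fun q => (v q).arg) (1, 0, 0) :=
      ContinuousAt.comp (Complex.continuousAt_arg (by simp [hv1, Complex.mem_slitPlane_iff]))
        hv.continuousAt
    fun_prop
  · simp only [hu1, hv1, Complex.arg_one, Complex.arg_I, Complex.norm_I, sub_self, Prod.mk.injEq,
      true_and, and_true]
    ring
  · intro q
    have h1 : 1 + 2 * ((v q).arg - 1) / 2 = (v q).arg := by ring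
    simp only [Phi, h1, sub_add_cancel, Complex.norm_mul_sin_arg, Complex.norm_mul_cos_arg]
    simp only [v, Complex.norm_mul_sin_arg, Complex.norm_mul_cos_arg, u]

theorem stmt_16 (Ω : Set (ℝ × ℝ × ℝ)) (hΩopen : IsOpen Ω) (hΩconn : IsConnected Ω)
    (hΩsub : S4 ⊆ Ω) (r : ℝ × ℝ × ℝ → ℝ) (hr : AnalyticOn ℝ r Ω)
    (hvanish : ∀ p ∈ S4, r p = 0) :
    ∀ p ∈ Ω, r p = 0 := by
  have hr' : AnalyticOnNhd ℝ r Ω := hΩopen.analyticOn_iff_analyticOnNhd.1 hr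
  have hW : IsOpen (Phi ⁻¹' Ω) := hΩopen.preimage continuous_Phi
  have hf : AnalyticOnNhd ℝ (r ∘ Phi) (Phi ⁻¹' Ω) := fun p hp =>
    (hr' _ hp).comp (analyticOnNhd_Phi p (mem_univ p))
  have hpi := Real.pi_gt_three
  have hpi4 := Real.pi_lt_four
  obtain ⟨g, hgc, hg0, hg⟩ := exists_local_inverse_Phi
  have hmem : Phi (0, Real.pi - 2, 0) ∈ S4 :=
    Phi_mem_S4 (by simp) (by linarith) (by linarith)
  have hzero : ∀ᶠ p in 𝓝 ((0 : ℝ), Real.pi - 2, (0 : ℝ)), (r ∘ Phi) p = 0 := by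
    refine eventually_eq_zero_of_zDeriv_eq_zero hW hf (hΩsub hmem) ?_
    have hopen : Ioo (-1 : ℝ) 1 ×ˢ Ioo (-2 : ℝ) 2 ∈ 𝓝 ((0 : ℝ), Real.pi - 2) :=
      prod_mem_nhds (Ioo_mem_nhds (by norm_num) (by norm_num))
        (Ioo_mem_nhds (by linarith) (by linarith))
    filter_upwards [hopen] with q hq k
    exact zDeriv_eq_zero_on_sphere hW (preimage_mono hΩsub) hf (fun p hp => hvanish _ hp) k _ _
      (abs_lt.2 hq.1) hq.2.1 hq.2.2
  have h1 : ((1 : ℝ), (0 : ℝ), (0 : ℝ)) ∈ Ω := by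
    have := hΩsub hmem
    rwa [← hg0, hg] at this
  refine hr'.eqOn_zero_of_preconnected_of_eventuallyEq_zero hΩconn.isPreconnected h1 ?_
  rw [← hg0] at hzero
  filter_upwards [hgc.eventually hzero] with q hq
  simpa [hg] using hq
end
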